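/- arXiv:1905.04731 — 4 statements merged into one kernel-verified Lean document; each statement's English description precedes it below -/
import Mathlib

section
/- Let R be a commutative Noetherian local ring and C a semidualizing R-module, i.e., C is finitely generated, the natural ring map R → Hom_R(C,C) sending r to multiplication by r is bijective, and Ext^i_R(C,C) = 0 for all i ≥ 1. Then the following are equivalent: (i) C ≅ R; (ii) C is totally reflexive; (iii) C has finite Gorenstein dimension; (iv) C has finite reducing Gorenstein dimension. -/
open CategoryTheory

universe u

variable (R : Type u) [CommRing R]

/-- `SES R A B C` : there is a short exact sequence `0 → A → B → C → 0` of `R`-modules. -/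
def SES (A B C : ModuleCat.{u} R) : Prop :=
  ∃ (f : A →ₗ[R] B) (g : B →ₗ[R] C),
    Function.Injective f ∧ Function.Surjective g ∧ LinearMap.range f = LinearMap.ker g

/-- A finitely generated free module. -/
def IsFinFree (F : ModuleCat.{u} R) : Prop :=
  Module.Finite R F ∧ Module.Free R F

/-- `IsSyzygy R n S K` : `S` is an `n`-th syzygy of `K`, i.e. there is an exact sequence
`0 → S → F_{n-1} → ⋯ → F_0 → K → 0` with each `F_j` finitely generated free
(for `n = 0` this just means `S ≅ K`). -/
def IsSyzygy : ℕ → ModuleCat.{u} R → ModuleCat.{u} R → Prop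
  | 0, S, K => Nonempty (S ≃ₗ[R] K)
  | n + 1, S, K => ∃ T F : ModuleCat.{u} R, IsSyzygy n T K ∧ IsFinFree R F ∧ SES R S F T

/-- The direct sum `M^{⊕ a}`. -/
def MPow (M : ModuleCat.{u} R) (a : ℕ) : ModuleCat.{u} R := ModuleCat.of R (Fin a → M)

/-- `IsReducingSeq R K` : the finitely generated modules `K 0, …, K r` form a reducing
sequence, i.e. there are positive integers `a i, b i, n i` and short exact sequences
`0 → (K i)^{⊕ a i} → K (i+1) → S i → 0` where `S i` is an `(n i)`-th syzygy
of `(K i)^{⊕ b i}`. -/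
def IsReducingSeq {r : ℕ} (K : Fin (r + 1) → ModuleCat.{u} R) : Prop :=
  (∀ i, Module.Finite R (K i)) ∧
  ∃ a b n : Fin r → ℕ,
    (∀ i, 0 < a i) ∧ (∀ i, 0 < b i) ∧ (∀ i, 0 < n i) ∧
    ∀ i : Fin r, ∃ S : ModuleCat.{u} R,
      IsSyzygy R (n i) S (MPow R (K i.castSucc) (b i)) ∧
      SES R (MPow R (K i.castSucc) (a i)) (K i.succ) S

/-- `ExtVanishes R M N i` : the `R`-module `Ext^i_R(M, N)` is zero. -/
def ExtVanishes (M N : ModuleCat.{u} R) (i : ℕ) : Prop :=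
  Subsingleton (((Ext R (ModuleCat.{u} R) i).obj (Opposite.op M)).obj N)

/-- A totally reflexive module. -/
def IsTotallyReflexive (M : ModuleCat.{u} R) : Prop :=
  Function.Bijective (Module.Dual.eval R M) ∧
  ∀ i : ℕ, 1 ≤ i →
    ExtVanishes R M (ModuleCat.of R R) i ∧
    ExtVanishes R (ModuleCat.of R (Module.Dual R M)) (ModuleCat.of R R) i

/-- `ResolvedBy R P m M` : there is an exact sequence `0 → G_m → ⋯ → G_0 → M → 0`
in which each `G_j` satisfies `P`. -/
def ResolvedBy (P : ModuleCat.{u} R → Prop) : ℕ → ModuleCat.{u} R → Prop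
  | 0, M => ∃ G : ModuleCat.{u} R, P G ∧ Nonempty (G ≃ₗ[R] M)
  | m + 1, M => ∃ G S : ModuleCat.{u} R, P G ∧ SES R S G M ∧ ResolvedBy P m S

/-- Finite Gorenstein dimension. -/
def FiniteGdim (M : ModuleCat.{u} R) : Prop :=
  ∃ m : ℕ, ResolvedBy R (IsTotallyReflexive R) m M

/-- Finite projective dimension. -/
def FinitePd (M : ModuleCat.{u} R) : Prop :=
  ∃ m : ℕ, ResolvedBy R (fun G => Module.Projective R G) m M

/-- `HasRedSeqTo R P M` : `M` admits a reducing sequence `K_0 = M, K_1, …, K_r`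
whose last module `K_r` satisfies `P`. -/
def HasRedSeqTo (P : ModuleCat.{u} R → Prop) (M : ModuleCat.{u} R) : Prop :=
  ∃ (r : ℕ) (K : Fin (r + 1) → ModuleCat.{u} R),
    K 0 = M ∧ IsReducingSeq R K ∧ P (K (Fin.last r))

/-- Finite reducing Gorenstein dimension. -/
def FiniteRedGdim (M : ModuleCat.{u} R) : Prop :=
  HasRedSeqTo R (FiniteGdim R) M

/-- Finite reducing projective dimension. -/
def FiniteRedPd (M : ModuleCat.{u} R) : Prop :=
  HasRedSeqTo R (FinitePd R) M

open CategoryTheory Limits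

namespace SDZ

section API
variable {R : Type u} [CommRing R]

/-- vanishing of Ext (derived category version), unbundled -/
abbrev EZ (R : Type u) [CommRing R] (M N : Type u) [AddCommGroup M] [Module R M]
    [AddCommGroup N] [Module R N] (i : ℕ) : Prop :=
  Subsingleton (Abelian.Ext (ModuleCat.of R M) (ModuleCat.of R N) i)

theorem extVanishes_iff (M N : ModuleCat.{u} R) (i : ℕ) :
    ExtVanishes R M N (i + 1) ↔ EZ R M N (i + 1) := by
  let P := projectiveResolution M
  have h1 : ExtVanishes R M N (i + 1) ↔ (P.complex.linearYonedaObj R N).ExactAt (i + 1) := by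
    rw [HomologicalComplex.exactAt_iff_isZero_homology]
    unfold ExtVanishes
    rw [← ModuleCat.isZero_iff_subsingleton]
    exact (P.isoExt (R := R) (i + 1) N).isZero_iff
  have h2 : (P.complex.linearYonedaObj R N).ExactAt (i + 1) ↔
      ∀ f : P.complex.X (i + 1) ⟶ N, P.complex.d (i + 2) (i + 1) ≫ f = 0 →
        ∃ g : P.complex.X i ⟶ N, P.complex.d (i + 1) i ≫ g = f := by
    rw [HomologicalComplex.exactAt_iff' _ i (i + 1) (i + 2) (by simp) (by simp),
      ShortComplex.moduleCat_exact_iff]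
    rfl
  rw [h1, h2]
  constructor
  · intro h
    refine subsingleton_of_forall_eq 0 fun α => ?_
    obtain ⟨f, hf, rfl⟩ := P.extMk_surjective α (i + 2) rfl
    rw [P.extMk_eq_zero_iff f (i + 2) rfl hf i rfl]
    exact h f hf
  · intro h f hf
    rw [← P.extMk_eq_zero_iff f (i + 2) rfl hf i rfl]
    exact Subsingleton.elim _ _

variable {A B C M N N' X : Type u} [AddCommGroup A] [Module R A] [AddCommGroup B] [Module R B]
  [AddCommGroup C] [Module R C] [AddCommGroup M] [Module R M] [AddCommGroup N] [Module R N]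
  [AddCommGroup N'] [Module R N'] [AddCommGroup X] [Module R X]

/-- the short complex -/
abbrev sc (f : A →ₗ[R] B) (g : B →ₗ[R] C) (h : Function.Exact f g) :
    ShortComplex (ModuleCat.{u} R) :=
  ShortComplex.mk (ModuleCat.ofHom f) (ModuleCat.ofHom g)
    (by ext x; exact h.apply_apply_eq_zero x)

theorem sc_shortExact {f : A →ₗ[R] B} {g : B →ₗ[R] C} (hf : Function.Injective f)
    (hg : Function.Surjective g) (h : Function.Exact f g) : (sc f g h).ShortExact where
  exact := by
    rw [ShortComplex.moduleCat_exact_iff]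
    intro x hx
    exact (h x).1 hx
  mono_f := (ModuleCat.mono_iff_injective _).2 hf
  epi_g := (ModuleCat.epi_iff_surjective _).2 hg

theorem ez_proj (P N : Type u) [AddCommGroup P] [Module R P] [AddCommGroup N] [Module R N]
    [Module.Projective R P] (i : ℕ) : EZ R P N (i + 1) :=
  Abelian.Ext.subsingleton_of_projective _ _ i

theorem ez_mid {f : A →ₗ[R] B} {g : B →ₗ[R] C} (hf : Function.Injective f)
    (hg : Function.Surjective g) (h : Function.Exact f g) {i : ℕ}
    (h1 : EZ R A N i) (h3 : EZ R C N i) : EZ R B N i := by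
  refine subsingleton_of_forall_eq 0 fun x => ?_
  obtain ⟨y, hy⟩ := Abelian.Ext.contravariant_sequence_exact₂ (sc_shortExact hf hg h) _ x
    (h1.elim _ _)
  rw [← hy, h3.elim y 0, Abelian.Ext.comp_zero]

theorem ez_left {f : A →ₗ[R] B} {g : B →ₗ[R] C} (hf : Function.Injective f)
    (hg : Function.Surjective g) (h : Function.Exact f g) {i : ℕ}
    (h1 : EZ R B N i) (h3 : EZ R C N (i + 1)) : EZ R A N i := by
  refine subsingleton_of_forall_eq 0 fun x => ?_
  obtain ⟨y, hy⟩ := Abelian.Ext.contravariant_sequence_exact₁ (sc_shortExact hf hg h) _ x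
    (add_comm 1 i) (h3.elim _ _)
  rw [← hy, h1.elim y 0, Abelian.Ext.comp_zero]

theorem ez_right {f : A →ₗ[R] B} {g : B →ₗ[R] C} (hf : Function.Injective f)
    (hg : Function.Surjective g) (h : Function.Exact f g) {i : ℕ}
    (h1 : EZ R A N i) (h3 : EZ R B N (i + 1)) : EZ R C N (i + 1) := by
  refine subsingleton_of_forall_eq 0 fun x => ?_
  obtain ⟨y, hy⟩ := Abelian.Ext.contravariant_sequence_exact₃ (sc_shortExact hf hg h) _ x
    (h3.elim _ _) (add_comm 1 i)
  rw [← hy, h1.elim y 0, Abelian.Ext.comp_zero]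

theorem hom_lift {f : A →ₗ[R] B} {g : B →ₗ[R] C} (hf : Function.Injective f)
    (hg : Function.Surjective g) (h : Function.Exact f g) 
    (h3 : EZ R C N 1) (φ : A →ₗ[R] N) : ∃ ψ : B →ₗ[R] N, ψ ∘ₗ f = φ := by
  obtain ⟨y, hy⟩ := Abelian.Ext.contravariant_sequence_exact₁ (sc_shortExact hf hg h)
    (ModuleCat.of R N) (Abelian.Ext.mk₀ (ModuleCat.ofHom φ)) (add_comm 1 0) (h3.elim _ _)
  obtain ⟨ψ, rfl⟩ := (Abelian.Ext.mk₀_bijective _ _).2 y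
  rw [Abelian.Ext.mk₀_comp_mk₀] at hy
  have := (Abelian.Ext.mk₀_bijective _ _).1 hy
  refine ⟨ψ.hom, ?_⟩
  have h4 := congrArg ModuleCat.Hom.hom this
  exact h4

theorem ez_one {f : A →ₗ[R] B} {g : B →ₗ[R] C} (hf : Function.Injective f)
    (hg : Function.Surjective g) (h : Function.Exact f g) 
    (h1 : ∀ φ : A →ₗ[R] N, ∃ ψ : B →ₗ[R] N, ψ ∘ₗ f = φ) (h3 : EZ R B N 1) : EZ R C N 1 := by
  refine subsingleton_of_forall_eq 0 fun x => ?_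
  obtain ⟨y, hy⟩ := Abelian.Ext.contravariant_sequence_exact₃ (sc_shortExact hf hg h) _ x
    (h3.elim _ _) (add_comm 1 0)
  obtain ⟨φ, rfl⟩ := (Abelian.Ext.mk₀_bijective _ _).2 y
  obtain ⟨ψ, hψ⟩ := h1 φ.hom
  have : φ = ModuleCat.ofHom f ≫ ModuleCat.ofHom ψ := by
    ext x; exact (LinearMap.congr_fun hψ x).symm
  rw [← hy, this, ← Abelian.Ext.mk₀_comp_mk₀, ← Abelian.Ext.comp_assoc _ _ _ (add_zero 1)
    (add_zero 0) (by simp)]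
  have h5 := (sc_shortExact hf hg h).extClass_comp
  erw [h5]
  simp

/-- retract in the first variable -/
theorem ez_retract {i : ℕ} (s : A →ₗ[R] B) (r : B →ₗ[R] A) (h : r ∘ₗ s = LinearMap.id)
    (hB : EZ R B N i) : EZ R A N i := by
  refine subsingleton_of_forall_eq 0 fun x => ?_
  have h1 : (Abelian.Ext.mk₀ (ModuleCat.ofHom s)).comp
      ((Abelian.Ext.mk₀ (ModuleCat.ofHom r)).comp x (zero_add i)) (zero_add i) = x := by
    rw [Abelian.Ext.mk₀_comp_mk₀_assoc, ← ModuleCat.ofHom_comp, h]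
    exact Abelian.Ext.mk₀_id_comp x
  rw [← h1, hB.elim (Abelian.Ext.comp _ x _) 0, Abelian.Ext.comp_zero]

theorem ez_equiv {i : ℕ} (e : A ≃ₗ[R] B) (hB : EZ R B N i) : EZ R A N i :=
  ez_retract e.toLinearMap e.symm.toLinearMap (by ext; simp) hB

/-- covariance of Ext -/
noncomputable def pf (X : Type u) [AddCommGroup X] [Module R X] (f : N →ₗ[R] N') (i : ℕ) :
    Abelian.Ext (ModuleCat.of R X) (ModuleCat.of R N) i →ₗ[R]
      Abelian.Ext (ModuleCat.of R X) (ModuleCat.of R N') i where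
  toFun α := α.comp (Abelian.Ext.mk₀ (ModuleCat.ofHom f)) (add_zero i)
  map_add' _ _ := Abelian.Ext.add_comp _ _ _ _
  map_smul' _ _ := Abelian.Ext.smul_comp _ _ _ _

theorem pf_comp (f : A →ₗ[R] B) (g : B →ₗ[R] C) (i : ℕ) (α) :
    pf X g i (pf X f i α) = pf X (g ∘ₗ f) i α := by
  simp [pf, ModuleCat.ofHom_comp, ← Abelian.Ext.mk₀_comp_mk₀]

theorem pf_id (i : ℕ) (α) : pf X (LinearMap.id : A →ₗ[R] A) i α = α :=
  Abelian.Ext.comp_mk₀_id α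

theorem pf_add (f g : A →ₗ[R] B) (i : ℕ) (α) :
    pf X (f + g) i α = pf X f i α + pf X g i α := by
  change Abelian.Ext.comp _ _ (add_zero i) = _
  rw [ModuleCat.ofHom_add, Abelian.Ext.mk₀_add, Abelian.Ext.comp_add]
  rfl

theorem pf_smul (r : R) (f : A →ₗ[R] B) (i : ℕ) (α) :
    pf X (r • f) i α = r • pf X f i α := by
  change Abelian.Ext.comp _ _ (add_zero i) = _
  have h : ModuleCat.ofHom (r • f) = r • ModuleCat.ofHom f := rfl
  rw [h, Abelian.Ext.mk₀_smul, Abelian.Ext.comp_smul]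
  rfl

theorem pf_zero (i : ℕ) (α) : pf X (0 : A →ₗ[R] B) i α = 0 := by
  have := pf_smul (X := X) (0 : R) (0 : A →ₗ[R] B) i α
  simpa using this

theorem pf_exact {f : A →ₗ[R] B} {g : B →ₗ[R] C} (hf : Function.Injective f)
    (hg : Function.Surjective g) (h : Function.Exact f g) (i : ℕ) :
    Function.Exact (pf X f i) (pf X g i) := by
  intro x
  constructor
  · exact Abelian.Ext.covariant_sequence_exact₂ (ModuleCat.of R X) (sc_shortExact hf hg h) x
  · rintro ⟨y, rfl⟩
    rw [pf_comp, h.linearMap_comp_eq_zero, pf_zero]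

theorem pf_inj {f : A →ₗ[R] B} {g : B →ₗ[R] C} (hf : Function.Injective f)
    (hg : Function.Surjective g) (h : Function.Exact f g) (i : ℕ)
    (h3 : ∀ j, j < i → EZ R X C j) :
    Function.Injective (pf X f i) := by
  rcases i with _ | i
  · have : Mono (ModuleCat.ofHom f) := (ModuleCat.mono_iff_injective _).2 hf
    exact Abelian.Ext.postcomp_mk₀_injective_of_mono _ _
  · rw [injective_iff_map_eq_zero]
    intro a ha
    obtain ⟨y, hy⟩ := Abelian.Ext.covariant_sequence_exact₁ (ModuleCat.of R X)
      (sc_shortExact hf hg h) a ha rfl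
    rw [← hy, (h3 i (by omega)).elim y 0, Abelian.Ext.zero_comp]

theorem ez_cov_left {f : A →ₗ[R] B} {g : B →ₗ[R] C} (hf : Function.Injective f)
    (hg : Function.Surjective g) (h : Function.Exact f g) (i : ℕ)
    (h3 : ∀ j, j < i → EZ R X C j) (h2 : EZ R X B i) : EZ R X A i :=
  (pf_inj hf hg h i h3).subsingleton

theorem ez_cov_retract {i : ℕ} (s : A →ₗ[R] B) (r : B →ₗ[R] A) (h : r ∘ₗ s = LinearMap.id)
    (hB : EZ R X B i) : EZ R X A i := by
  have : Function.LeftInverse (pf X r i) (pf X s i) := fun x => by rw [pf_comp, h, pf_id]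
  exact this.injective.subsingleton

end API
end SDZ
namespace SDZ

section Phi
variable {R : Type u} [CommRing R]
variable {A B C M M' N N' X : Type u} [AddCommGroup A] [Module R A] [AddCommGroup B] [Module R B]
  [AddCommGroup C] [Module R C] [AddCommGroup M] [Module R M] [AddCommGroup N] [Module R N]
  [AddCommGroup N'] [Module R N'] [AddCommGroup X] [Module R X] [AddCommGroup M'] [Module R M']

/-- `pf` as a linear map in the homomorphism -/
noncomputable def pfl (i : ℕ)
    (α : Abelian.Ext (ModuleCat.of R X) (ModuleCat.of R N) i) :
    (N →ₗ[R] N') →ₗ[R] Abelian.Ext (ModuleCat.of R X) (ModuleCat.of R N') i where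
  toFun f := pf X f i α
  map_add' f g := pf_add f g i α
  map_smul' r f := pf_smul r f i α

/-- The natural map `Ext(X, Hom(M,N)) → Hom(M, Ext(X,N))` -/
noncomputable def Phi (X M N : Type u) [AddCommGroup M] [Module R M] [AddCommGroup N] [Module R N]
    [AddCommGroup X] [Module R X] (t : ℕ) :
    Abelian.Ext (ModuleCat.of R X) (ModuleCat.of R (M →ₗ[R] N)) t →ₗ[R]
      (M →ₗ[R] Abelian.Ext (ModuleCat.of R X) (ModuleCat.of R N) t) where
  toFun α := (pfl t α) ∘ₗ (LinearMap.applyₗ : M →ₗ[R] (M →ₗ[R] N) →ₗ[R] N)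
  map_add' α β := by
    ext m
    exact map_add (pf X (LinearMap.applyₗ m) t) α β
  map_smul' r α := by
    ext m
    exact map_smul (pf X (LinearMap.applyₗ m) t) r α

theorem Phi_apply (t : ℕ) (α) (m : M) :
    Phi (R := R) X M N t α m = pf X (LinearMap.applyₗ m) t α := rfl

theorem Phi_nat (u : M' →ₗ[R] M) (t : ℕ) (α) :
    Phi X M' N t (pf X (LinearMap.lcomp R N u) t α) = Phi X M N t α ∘ₗ u := by
  ext m
  rw [Phi_apply, pf_comp]
  rfl

theorem Phi_inj_free {ι : Type*} [Fintype ι] (b : Module.Basis ι R M) (t : ℕ) :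
    Function.Injective (Phi (R := R) X M N t) := by
  classical
  rw [injective_iff_map_eq_zero]
  intro α hα
  have hid : (LinearMap.id : (M →ₗ[R] N) →ₗ[R] (M →ₗ[R] N)) =
      ∑ i, (LinearMap.smulRightₗ (b.coord i)) ∘ₗ (LinearMap.applyₗ (b i)) := by
    refine LinearMap.ext fun f => b.ext fun j => ?_
    simp [LinearMap.sum_apply, Finsupp.single_apply]
  have h2 : pfl t α LinearMap.id = 0 := by
    rw [hid, map_sum]
    refine Finset.sum_eq_zero fun i _ => ?_
    change pf X _ t α = 0
    rw [← pf_comp, ← Phi_apply, hα]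
    simp
  rw [← pf_id t α]
  exact h2

theorem Phi_surj_free {ι : Type*} [Fintype ι] (b : Module.Basis ι R M) (t : ℕ) :
    Function.Surjective (Phi (R := R) X M N t) := by
  classical
  intro φ
  refine ⟨∑ i, pf X (LinearMap.smulRightₗ (b.coord i)) t (φ (b i)), b.ext fun j => ?_⟩
  rw [map_sum, LinearMap.sum_apply, Finset.sum_eq_single j]
  · rw [Phi_apply, pf_comp]
    have h1 : (LinearMap.applyₗ (b j)) ∘ₗ (LinearMap.smulRightₗ (b.coord j)) =
        (LinearMap.id : N →ₗ[R] N) := by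
      ext x
      simp
    rw [h1]
    exact pf_id t (φ (b j))
  · intro i _ hij
    rw [Phi_apply, pf_comp]
    have h1 : (LinearMap.applyₗ (b j)) ∘ₗ (LinearMap.smulRightₗ (b.coord i)) =
        (0 : N →ₗ[R] N) := by
      ext x
      simp [Finsupp.single_apply, hij.symm]
    rw [h1]
    exact pf_zero t (φ (b i))
  · simp

/-- all positive Ext vanish -/
abbrev EV (R : Type u) [CommRing R] (M N : Type u) [AddCommGroup M] [Module R M]
    [AddCommGroup N] [Module R N] : Prop := ∀ i : ℕ, EZ R M N (i + 1)

theorem ev_ker {f : A →ₗ[R] B} {g : B →ₗ[R] C} (hf : Function.Injective f)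
    (hg : Function.Surjective g) (h : Function.Exact f g)
    (hB : EV R B N) (hC : EV R C N) : EV R A N :=
  fun i => ez_left hf hg h (hB i) (hC (i + 1))

theorem lcomp_inj {g : B →ₗ[R] C} (hg : Function.Surjective g) :
    Function.Injective (LinearMap.lcomp R N g) := by
  intro a b hab
  ext x
  obtain ⟨y, rfl⟩ := hg x
  exact LinearMap.congr_fun hab y

theorem lcomp_exact {f : A →ₗ[R] B} {g : B →ₗ[R] C} 
    (hg : Function.Surjective g) (h : Function.Exact f g) :
    Function.Exact (LinearMap.lcomp R N g) (LinearMap.lcomp R N f) := by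
  intro φ
  constructor
  · intro hφ
    have hk : LinearMap.ker g ≤ LinearMap.ker φ := by
      intro x hx
      obtain ⟨y, rfl⟩ := (h x).1 hx
      exact LinearMap.congr_fun hφ y
    refine ⟨(LinearMap.ker g).liftQ φ hk ∘ₗ (g.quotKerEquivOfSurjective hg).symm.toLinearMap, ?_⟩
    ext x
    have : (g.quotKerEquivOfSurjective hg).symm (g x) = Submodule.Quotient.mk x := by
      rw [LinearEquiv.symm_apply_eq]; rfl
    simp [this]
  · rintro ⟨ψ, rfl⟩
    ext x
    simp [h.apply_apply_eq_zero x]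

theorem ker_exact (p : B →ₗ[R] C) : Function.Exact (LinearMap.ker p).subtype p := by
  intro x; simp

variable [IsNoetherianRing R]

theorem ez_hom (j : ℕ) (hN : ∀ i ≤ j, EZ R X N i) :
    ∀ (M : Type u) [AddCommGroup M] [Module R M] [Module.Finite R M], EV R M N →
      EZ R X (M →ₗ[R] N) j := by
  induction j using Nat.strong_induction_on with
  | _ j ih =>
    intro M _ _ _ hM
    obtain ⟨n, p, hp⟩ := Module.Finite.exists_fin' R M
    have hS : EV R (LinearMap.ker p) N :=
      ev_ker (Submodule.injective_subtype _) hp (ker_exact p) (fun i => ez_proj _ _ i) hM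
    refine ez_cov_left (lcomp_inj hp) ?_ (lcomp_exact hp (ker_exact p)) j ?_ ?_
    · intro φ
      exact hom_lift (Submodule.injective_subtype _) hp (ker_exact p) (hM 0) φ
    · intro i hi
      exact ih i hi (fun l hl => hN l (by omega)) _ hS
    · have := hN j le_rfl
      have h2 : Subsingleton ((Fin n → R) →ₗ[R]
          Abelian.Ext (ModuleCat.of R X) (ModuleCat.of R N) j) :=
        ⟨fun a b => by ext; exact Subsingleton.elim _ _⟩
      exact (Phi_inj_free (X := X) (N := N) (Pi.basisFun R (Fin n)) j).subsingleton

theorem Phi_inj (t : ℕ) (hN : ∀ i < t, EZ R X N i) [Module.Finite R M] (hM : EV R M N) :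
    Function.Injective (Phi (R := R) X M N t) := by
  obtain ⟨n, p, hp⟩ := Module.Finite.exists_fin' R M
  have hS : EV R (LinearMap.ker p) N :=
    ev_ker (Submodule.injective_subtype _) hp (ker_exact p) (fun i => ez_proj _ _ i) hM
  have hinj : Function.Injective (pf X (LinearMap.lcomp R N p) t) := by
    refine pf_inj (lcomp_inj hp) ?_ (lcomp_exact hp (ker_exact p)) t ?_
    · intro φ
      exact hom_lift (Submodule.injective_subtype _) hp (ker_exact p) (hM 0) φ
    · intro i hi
      exact ez_hom i (fun l hl => hN l (by omega)) _ hS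
  rw [injective_iff_map_eq_zero]
  intro α hα
  apply hinj
  apply Phi_inj_free (Pi.basisFun R (Fin n)) t
  rw [Phi_nat, hα]
  simp

theorem Phi_surj (t : ℕ) (hN : ∀ i < t, EZ R X N i) [Module.Finite R M] (hM : EV R M N) :
    Function.Surjective (Phi (R := R) X M N t) := by
  obtain ⟨n, p, hp⟩ := Module.Finite.exists_fin' R M
  have hS : EV R (LinearMap.ker p) N :=
    ev_ker (Submodule.injective_subtype _) hp (ker_exact p) (fun i => ez_proj _ _ i) hM
  intro φ
  obtain ⟨β, hβ⟩ := Phi_surj_free (X := X) (N := N) (Pi.basisFun R (Fin n)) t (φ ∘ₗ p)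
  have h0 : pf X (LinearMap.lcomp R N (LinearMap.ker p).subtype) t β = 0 := by
    apply Phi_inj t hN hS
    rw [Phi_nat, hβ, map_zero]
    ext x
    simp
  obtain ⟨α, rfl⟩ := (pf_exact (X := X) (lcomp_inj hp) (fun φ =>
    hom_lift (Submodule.injective_subtype _) hp (ker_exact p) (hM 0) φ)
    (lcomp_exact hp (ker_exact p)) t β).1 h0
  refine ⟨α, ?_⟩
  rw [Phi_nat] at hβ
  ext x
  obtain ⟨y, rfl⟩ := hp x
  exact LinearMap.congr_fun hβ y

end Phi
end SDZ
namespace SDZ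

section Res
variable {R : Type u} [CommRing R]
variable {A B C M M' N N' X : Type u} [AddCommGroup A] [Module R A] [AddCommGroup B] [Module R B]
  [AddCommGroup C] [Module R C] [AddCommGroup M] [Module R M] [AddCommGroup N] [Module R N]
  [AddCommGroup N'] [Module R N'] [AddCommGroup X] [Module R X] [AddCommGroup M'] [Module R M']

/-- precomposition with multiplication by `r` -/
theorem smul_ext (r : R) (i : ℕ) (x : Abelian.Ext (ModuleCat.of R M) (ModuleCat.of R N) i) :
    (Abelian.Ext.mk₀ (ModuleCat.ofHom (r • LinearMap.id : M →ₗ[R] M))).comp x (zero_add i)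
      = r • x := by
  have h : ModuleCat.ofHom (r • LinearMap.id : M →ₗ[R] M) = r • 𝟙 (ModuleCat.of R M) := rfl
  rw [h, Abelian.Ext.mk₀_smul, Abelian.Ext.smul_comp, Abelian.Ext.mk₀_id_comp]

theorem ext_killed (I : Ideal R) (r : R) (hr : r ∈ I) (i : ℕ)
    (x : Abelian.Ext (ModuleCat.of R (R ⧸ I)) (ModuleCat.of R N) i) : r • x = 0 := by
  rw [← smul_ext]
  have h : (r • LinearMap.id : (R ⧸ I) →ₗ[R] (R ⧸ I)) = 0 := by
    ext
    simp [Algebra.smul_def, Ideal.Quotient.eq_zero_iff_mem.2 hr]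
  rw [h]
  have h2 : ModuleCat.ofHom (0 : (R ⧸ I) →ₗ[R] (R ⧸ I)) = 0 := rfl
  rw [h2, Abelian.Ext.mk₀_zero, Abelian.Ext.zero_comp]

variable [IsNoetherianRing R] [IsLocalRing R]

open IsLocalRing

theorem ez_all_prime (N : Type u) [AddCommGroup N] [Module R N] [Module.Finite R N]
    (h : ∀ i, EZ R (R ⧸ maximalIdeal R) N i) (p : Ideal R) :
    p.IsPrime → ∀ i, EZ R (R ⧸ p) N i := by
  have wf : WellFounded ((· > ·) : Ideal R → Ideal R → Prop) := wellFounded_gt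
  induction p using wf.induction with
  | _ p ih =>
  intro hp
  by_cases hpm : p = maximalIdeal R
  · subst hpm; exact h
  have hle : p ≤ maximalIdeal R := le_maximalIdeal hp.ne_top
  obtain ⟨y, hym, hyp⟩ := SetLike.exists_of_lt (lt_of_le_of_ne hle hpm)
  have key : ∀ (M : Type u) [AddCommGroup M] [Module R M] (_ : Module.Finite R M),
      (∀ r, (r ∈ p ∨ r = y) → ∀ m : M, r • m = 0) → ∀ i, EZ R M N i := by
    intro M _ _ hM
    induction hM using IsNoetherianRing.induction_on_isQuotientEquivQuotientPrime R with
    | subsingleton M =>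
      intro _ i
      refine ez_retract (B := R ⧸ maximalIdeal R) 0 0 ?_ (h i)
      ext x
      exact Subsingleton.elim _ _
    | quotient M q e =>
      intro hann i
      refine ez_equiv e (ih q.1 ?_ q.2 i)
      have hq : ∀ r, (r ∈ p ∨ r = y) → r ∈ q.1 := by
        intro r hr
        have := hann r hr (e.symm (Ideal.Quotient.mk _ 1))
        rw [← map_smul, LinearEquiv.map_eq_zero_iff] at this
        rw [← Ideal.Quotient.eq_zero_iff_mem, ← this, Algebra.smul_def]
        simp
      refine lt_of_le_of_ne (fun r hr => hq r (Or.inl hr)) ?_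
      intro heq
      exact hyp (heq ▸ hq y (Or.inr rfl))
    | exact M₁ M₂ M₃ f g hf hg hfg h1 h3 =>
      intro hann i
      refine ez_mid hf hg hfg (h1 ?_ i) (h3 ?_ i)
      · intro r hr m
        apply hf
        rw [map_smul, hann r hr, map_zero]
      · intro r hr m
        obtain ⟨m, rfl⟩ := hg m
        rw [← map_smul, hann r hr, map_zero]
  intro i
  let f : (R ⧸ p) →ₗ[R] (R ⧸ p) := y • LinearMap.id
  have hf : Function.Injective f := by
    rw [injective_iff_map_eq_zero]
    intro a ha
    have : (Ideal.Quotient.mk p y) * a = 0 := by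
      rw [← ha]; simp [f, Algebra.smul_def]
    rcases mul_eq_zero.1 this with h1 | h1
    · exact absurd (Ideal.Quotient.eq_zero_iff_mem.1 h1) hyp
    · exact h1
  have hfg : Function.Exact f (LinearMap.range f).mkQ := by
    intro x; simp
  have hC : ∀ i, EZ R ((R ⧸ p) ⧸ LinearMap.range f) N i := by
    apply key _ inferInstance
    intro r hr m
    obtain ⟨m, rfl⟩ := Submodule.mkQ_surjective _ m
    rcases hr with hr | rfl
    · rw [← map_smul, Algebra.smul_def]
      have : algebraMap R (R ⧸ p) r = 0 := Ideal.Quotient.eq_zero_iff_mem.2 hr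
      rw [this, zero_mul, map_zero]
    · rw [← map_smul, Submodule.mkQ_apply, Submodule.Quotient.mk_eq_zero]
      exact ⟨m, rfl⟩
  have hdiv : ∀ x : Abelian.Ext (ModuleCat.of R (R ⧸ p)) (ModuleCat.of R N) i,
      ∃ z, y • z = x := by
    intro x
    obtain ⟨z, hz⟩ := Abelian.Ext.contravariant_sequence_exact₁
      (sc_shortExact hf (Submodule.mkQ_surjective _) hfg) (ModuleCat.of R N) x
      (add_comm 1 i) ((hC (i + 1)).elim _ _)
    refine ⟨z, ?_⟩
    rw [← hz, ← smul_ext]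
  have hfin : Module.Finite R (Abelian.Ext (ModuleCat.of R (R ⧸ p)) (ModuleCat.of R N) i) :=
    inferInstance
  have htop : (⊤ : Submodule R (Abelian.Ext (ModuleCat.of R (R ⧸ p)) (ModuleCat.of R N) i)) = ⊥ := by
    refine Submodule.eq_bot_of_le_smul_of_le_jacobson_bot (maximalIdeal R) _
      hfin.fg_top ?_ (maximalIdeal_le_jacobson _)
    intro x _
    obtain ⟨z, rfl⟩ := hdiv x
    exact Submodule.smul_mem_smul hym trivial
  exact (Submodule.subsingleton_iff R).1 (subsingleton_of_bot_eq_top htop.symm)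

theorem exists_nonvanish : ∃ i, ¬ EZ R (R ⧸ maximalIdeal R) R i := by
  by_contra hcon
  push Not at hcon
  have key : ∀ (M : Type u) [AddCommGroup M] [Module R M] (_ : Module.Finite R M),
      ∀ i, EZ R M R i := by
    intro M _ _ hM
    induction hM using IsNoetherianRing.induction_on_isQuotientEquivQuotientPrime R with
    | subsingleton M =>
      intro i
      refine ez_retract (B := R ⧸ maximalIdeal R) 0 0 ?_ (hcon i)
      ext x
      exact Subsingleton.elim _ _
    | quotient M q e =>
      intro i
      exact ez_equiv e (ez_all_prime R hcon q.1 q.2 i)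
    | exact M₁ M₂ M₃ f g hf hg hfg h1 h3 =>
      intro i
      exact ez_mid hf hg hfg (h1 i) (h3 i)
  have h1 := key R inferInstance 0
  have h2 : (LinearMap.id : R →ₗ[R] R) = 0 := by
    have := (Abelian.Ext.mk₀_bijective (ModuleCat.of R R) (ModuleCat.of R R)).1
      (h1.elim (Abelian.Ext.mk₀ (ModuleCat.ofHom LinearMap.id))
        (Abelian.Ext.mk₀ (ModuleCat.ofHom 0)))
    exact congrArg ModuleCat.Hom.hom this
  have h3 := LinearMap.congr_fun h2 1
  simp at h3

theorem exists_depth : ∃ d, ¬ EZ R (R ⧸ maximalIdeal R) R d ∧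
    ∀ j < d, EZ R (R ⧸ maximalIdeal R) R j := by
  classical
  have h := exists_nonvanish (R := R)
  refine ⟨Nat.find h, Nat.find_spec h, fun j hj => ?_⟩
  have := Nat.find_min h hj
  push Not at this
  exact this

/-- a proper submodule of a f.g. module is killed by a surjection to the residue field -/
theorem exists_surj_res [Module.Finite R M] (U : Submodule R M) (hU : U ≠ ⊤) :
    ∃ π : M →ₗ[R] (R ⧸ maximalIdeal R), Function.Surjective π ∧ ∀ u ∈ U, π u = 0 := by
  obtain ⟨W, hW, hUW⟩ := (eq_top_or_exists_le_coatom U).resolve_left hU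
  have hs : IsSimpleModule R (M ⧸ W) := isSimpleModule_iff_isCoatom.2 hW
  obtain ⟨I, hI, ⟨e⟩⟩ := isSimpleModule_iff_quot_maximal.1 hs
  have : I = maximalIdeal R := eq_maximalIdeal hI
  subst this
  refine ⟨e.toLinearMap ∘ₗ W.mkQ, e.surjective.comp (Submodule.mkQ_surjective _), ?_⟩
  intro u hu
  have : W.mkQ u = 0 := by
    rw [Submodule.mkQ_apply, Submodule.Quotient.mk_eq_zero]; exact hUW hu
  simp only [LinearMap.comp_apply, this, map_zero]

/-- a hom from the residue field -/
theorem exists_res_hom {E : Type*} [AddCommGroup E] [Module R E]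
    (hE : ∀ r ∈ maximalIdeal R, ∀ e : E, r • e = 0) (e : E) :
    ∃ φ : (R ⧸ maximalIdeal R) →ₗ[R] E, φ (Ideal.Quotient.mk _ 1) = e := by
  refine ⟨(maximalIdeal R).liftQ (LinearMap.toSpanSingleton R E e) ?_, ?_⟩
  · intro r hr
    simpa using hE r hr e
  · exact (one_smul R e)

end Res
end SDZ
namespace SDZ

section Five
variable {R : Type u} [CommRing R]
variable {A B C A' B' C' : Type*} [AddCommGroup A] [Module R A] [AddCommGroup B] [Module R B]
  [AddCommGroup C] [Module R C] [AddCommGroup A'] [Module R A'] [AddCommGroup B'] [Module R B']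
  [AddCommGroup C'] [Module R C']
  {f : A →ₗ[R] B} {g : B →ₗ[R] C} {f' : A' →ₗ[R] B'} {g' : B' →ₗ[R] C'}
  {a : A →ₗ[R] A'} {b : B →ₗ[R] B'} {c : C →ₗ[R] C'}

theorem five_mid (h : Function.Exact f g) (hg : Function.Surjective g)
    (hf' : Function.Injective f') (h' : Function.Exact f' g')
    (hab : ∀ x, b (f x) = f' (a x)) (hbc : ∀ x, c (g x) = g' (b x))
    (ha : Function.Bijective a) (hc : Function.Bijective c) : Function.Bijective b := by
  constructor
  · rw [injective_iff_map_eq_zero]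
    intro x hx
    have h1 : g x = 0 := hc.1 (by rw [hbc, hx, map_zero, map_zero])
    obtain ⟨y, rfl⟩ := (h x).1 h1
    rw [hab] at hx
    have h2 : a y = 0 := hf' (by rw [hx, map_zero])
    have h3 : y = 0 := ha.1 (by rw [h2, map_zero])
    rw [h3, map_zero]
  · intro z
    obtain ⟨w, hw⟩ := hc.2 (g' z)
    obtain ⟨x, rfl⟩ := hg w
    have h1 : g' (z - b x) = 0 := by rw [map_sub, ← hw, hbc, sub_self]
    obtain ⟨v, hv⟩ := (h' _).1 h1
    obtain ⟨y, rfl⟩ := ha.2 v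
    refine ⟨x + f y, ?_⟩
    rw [map_add, hab, hv]
    abel

theorem five_left (hf : Function.Injective f) (h : Function.Exact f g)
    (hf' : Function.Injective f') (h' : Function.Exact f' g')
    (hab : ∀ x, b (f x) = f' (a x)) (hbc : ∀ x, c (g x) = g' (b x))
    (hb : Function.Bijective b) (hc : Function.Bijective c) : Function.Bijective a := by
  constructor
  · rw [injective_iff_map_eq_zero]
    intro y hy
    apply hf
    apply hb.1
    rw [hab, hy]; simp
  · intro w
    obtain ⟨x, hx⟩ := hb.2 (f' w)
    have h1 : g x = 0 := hc.1 (by rw [hbc, hx, h'.apply_apply_eq_zero, map_zero])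
    obtain ⟨y, rfl⟩ := (h x).1 h1
    exact ⟨y, hf' (by rw [← hab, hx])⟩

theorem five_right (h : Function.Exact f g) (hg : Function.Surjective g)
    (h' : Function.Exact f' g') (hg' : Function.Surjective g')
    (hab : ∀ x, b (f x) = f' (a x)) (hbc : ∀ x, c (g x) = g' (b x))
    (ha : Function.Bijective a) (hb : Function.Bijective b) : Function.Bijective c := by
  constructor
  · rw [injective_iff_map_eq_zero]
    intro z hz
    obtain ⟨x, rfl⟩ := hg z
    rw [hbc] at hz
    obtain ⟨w, hw⟩ := (h' _).1 hz
    obtain ⟨y, rfl⟩ := ha.2 w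
    rw [← hab] at hw
    rw [← hb.1 hw]
    exact h.apply_apply_eq_zero y
  · intro z
    obtain ⟨v, rfl⟩ := hg' z
    obtain ⟨x, rfl⟩ := hb.2 v
    exact ⟨g x, hbc x⟩

end Five

section TRsec
variable {R : Type u} [CommRing R]
variable {A B C M N : Type u} [AddCommGroup A] [Module R A] [AddCommGroup B] [Module R B]
  [AddCommGroup C] [Module R C] [AddCommGroup M] [Module R M] [AddCommGroup N] [Module R N]

/-- totally reflexive, unbundled -/
structure TR (R : Type u) [CommRing R] (M : Type u) [AddCommGroup M] [Module R M] : Prop where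
  bij : Function.Bijective (Module.Dual.eval R M)
  ev : EV R M R
  evd : EV R (M →ₗ[R] R) R

theorem tr_iff (M : ModuleCat.{u} R) : IsTotallyReflexive R M ↔ TR R M := by
  constructor
  · rintro ⟨h1, h2⟩
    exact ⟨h1, fun i => (extVanishes_iff _ _ i).1 (h2 (i + 1) (by omega)).1,
      fun i => (extVanishes_iff _ _ i).1 (h2 (i + 1) (by omega)).2⟩
  · rintro ⟨h1, h2, h3⟩
    refine ⟨h1, fun i hi => ?_⟩
    obtain ⟨i, rfl⟩ : ∃ j, i = j + 1 := ⟨i - 1, by omega⟩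
    exact ⟨(extVanishes_iff _ _ i).2 (h2 i), (extVanishes_iff _ _ i).2 (h3 i)⟩

theorem tr_free [Module.Finite R M] [Module.Projective R M] : TR R M where
  bij := Module.bijective_dual_eval R M
  ev i := ez_proj _ _ i
  evd i := by
    have : Module.Projective R (M →ₗ[R] R) := inferInstanceAs (Module.Projective R (Module.Dual R M))
    exact ez_proj _ _ i

theorem tr_retract (s : A →ₗ[R] B) (r : B →ₗ[R] A) (h : r ∘ₗ s = LinearMap.id)
    (hB : TR R B) : TR R A where
  bij := by
    constructor
    · intro x y hxy
      have h1 : Module.Dual.eval R B (s x) = Module.Dual.eval R B (s y) := by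
        ext φ
        exact LinearMap.congr_fun hxy (φ ∘ₗ s)
      have h2 := congrArg r (hB.bij.1 h1)
      have h3 := fun x => LinearMap.congr_fun h x
      simp only [LinearMap.comp_apply, LinearMap.id_apply] at h3
      rwa [h3, h3] at h2
    · intro w
      obtain ⟨x, hx⟩ := hB.bij.2 (w ∘ₗ LinearMap.lcomp R R s)
      refine ⟨r x, ?_⟩
      ext φ
      have h1 := LinearMap.congr_fun hx (φ ∘ₗ r)
      have h2 : (φ ∘ₗ r) ∘ₗ s = φ := by rw [LinearMap.comp_assoc, h, LinearMap.comp_id]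
      have h3 : (w ∘ₗ LinearMap.lcomp R R s) (φ ∘ₗ r) = w φ := by
        change w ((φ ∘ₗ r) ∘ₗ s) = w φ
        rw [h2]
      rw [h3] at h1
      exact h1
  ev i := ez_retract s r h (hB.ev i)
  evd i := by
    refine ez_retract (LinearMap.lcomp R R r) (LinearMap.lcomp R R s) ?_ (hB.evd i)
    ext φ x
    exact congrArg φ (LinearMap.congr_fun h x)

theorem tr_equiv (e : A ≃ₗ[R] B) (hB : TR R B) : TR R A :=
  tr_retract e.toLinearMap e.symm.toLinearMap (by ext; simp) hB

variable {f : A →ₗ[R] B} {g : B →ₗ[R] C}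

theorem eval_nat (f : A →ₗ[R] B) (x : A) : Module.Dual.eval R B (f x) =
    LinearMap.lcomp R R (LinearMap.lcomp R R f) (Module.Dual.eval R A x) := rfl

theorem tr_ext (hf : Function.Injective f) (hg : Function.Surjective g) (h : Function.Exact f g)
    (hA : TR R A) (hC : TR R C) : TR R B := by
  have H1 : Function.Surjective (LinearMap.lcomp R R f) := fun φ => hom_lift hf hg h (hC.ev 0) φ
  exact {
    bij := five_mid h hg (lcomp_inj (N := R) H1) (lcomp_exact (N := R) H1 (lcomp_exact hg h))
      (eval_nat f) (eval_nat g) hA.bij hC.bij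
    ev := fun i => ez_mid hf hg h (hA.ev i) (hC.ev i)
    evd := fun i => ez_mid (lcomp_inj hg) H1 (lcomp_exact hg h) (hC.evd i) (hA.evd i) }

theorem tr_ker (hf : Function.Injective f) (hg : Function.Surjective g) (h : Function.Exact f g)
    (hB : TR R B) (hC : TR R C) : TR R A := by
  have H1 : Function.Surjective (LinearMap.lcomp R R f) := fun φ => hom_lift hf hg h (hC.ev 0) φ
  have hbij : Function.Bijective (Module.Dual.eval R A) :=
    five_left hf h (lcomp_inj (N := R) H1) (lcomp_exact (N := R) H1 (lcomp_exact hg h))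
      (eval_nat f) (eval_nat g) hB.bij hC.bij
  refine ⟨hbij, ev_ker hf hg h hB.ev hC.ev, fun i => ?_⟩
  rcases i with _ | i
  · refine ez_one (lcomp_inj hg) H1 (lcomp_exact hg h) ?_ (hB.evd 0)
    intro φ
    obtain ⟨z, rfl⟩ := hC.bij.2 φ
    obtain ⟨x, rfl⟩ := hg z
    exact ⟨Module.Dual.eval R B x, rfl⟩
  · exact ez_right (lcomp_inj hg) H1 (lcomp_exact hg h) (hC.evd i) (hB.evd (i + 1))

theorem tr_coker (hf : Function.Injective f) (hg : Function.Surjective g) (h : Function.Exact f g)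
    (hA : TR R A) (hB : TR R B) (H1 : Function.Surjective (LinearMap.lcomp R R f)) : TR R C := by
  refine ⟨?_, fun i => ?_, ?_⟩
  · refine five_right h hg (lcomp_exact (N := R) H1 (lcomp_exact hg h)) ?_
      (eval_nat f) (eval_nat g) hA.bij hB.bij
    exact fun φ => hom_lift (lcomp_inj hg) H1 (lcomp_exact hg h) (hA.evd 0) φ
  · rcases i with _ | i
    · exact ez_one hf hg h H1 (hB.ev 0)
    · exact ez_right hf hg h (hA.ev i) (hB.ev (i + 1))
  · exact ev_ker (lcomp_inj hg) H1 (lcomp_exact hg h) hB.evd hA.evd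

theorem tr_prod (hA : TR R A) (hB : TR R B) : TR R (A × B) :=
  tr_ext (f := LinearMap.inl R A B) (g := LinearMap.snd R A B) LinearMap.inl_injective
    LinearMap.snd_surjective Function.Exact.inl_snd hA hB

end TRsec
end SDZ
namespace SDZ

section Resolved
variable {R : Type u} [CommRing R]

theorem exact_of_ses {A B C : Type u} [AddCommGroup A] [Module R A] [AddCommGroup B] [Module R B]
    [AddCommGroup C] [Module R C] {f : A →ₗ[R] B} {g : B →ₗ[R] C}
    (h : LinearMap.range f = LinearMap.ker g) : Function.Exact f g :=
  LinearMap.exact_iff.2 h.symm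

/-- finite resolution by totally reflexive modules -/
abbrev RB (R : Type u) [CommRing R] (m : ℕ) (M : Type u) [AddCommGroup M] [Module R M] : Prop :=
  ResolvedBy R (IsTotallyReflexive R) m (ModuleCat.of R M)

theorem rb_zero {M : Type u} [AddCommGroup M] [Module R M] : RB R 0 M ↔ TR R M := by
  constructor
  · rintro ⟨G, hG, ⟨e⟩⟩
    exact tr_equiv e.symm ((tr_iff G).1 hG)
  · intro h
    exact ⟨ModuleCat.of R M, (tr_iff _).2 h, ⟨LinearEquiv.refl R M⟩⟩

theorem rb_succ {m : ℕ} {M : Type u} [AddCommGroup M] [Module R M] (h : RB R (m + 1) M) :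
    ∃ (G S : ModuleCat.{u} R) (f : S →ₗ[R] G) (g : G →ₗ[R] M), TR R G ∧ RB R m S ∧
      Function.Injective f ∧ Function.Surjective g ∧ Function.Exact f g := by
  obtain ⟨G, S, hG, ⟨f, g, hf, hg, hfg⟩, hS⟩ := h
  exact ⟨G, S, f, g, (tr_iff G).1 hG, hS, hf, hg, exact_of_ses hfg⟩

theorem rb_succ' {m : ℕ} {M G S : Type u} [AddCommGroup M] [Module R M] [AddCommGroup G]
    [Module R G] [AddCommGroup S] [Module R S] {f : S →ₗ[R] G} {g : G →ₗ[R] M} (hG : TR R G)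
    (hS : RB R m S) (hf : Function.Injective f) (hg : Function.Surjective g)
    (hfg : Function.Exact f g) : RB R (m + 1) M :=
  ⟨ModuleCat.of R G, ModuleCat.of R S, (tr_iff _).2 hG,
    ⟨f, g, hf, hg, (LinearMap.exact_iff.1 hfg).symm⟩, hS⟩

theorem rb_prod (m : ℕ) (F : Type u) [AddCommGroup F] [Module R F] (hF : TR R F)
    (S : Type u) [AddCommGroup S] [Module R S] (hS : RB R m S) : RB R m (S × F) := by
  cases m with
  | zero => exact rb_zero.2 (tr_prod (rb_zero.1 hS) hF)
  | succ m =>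
    obtain ⟨G, S', f, g, hG, hS', hf, hg, hfg⟩ := rb_succ hS
    refine rb_succ' (G := G × F) (S := S') (f := LinearMap.inl R G F ∘ₗ f)
      (g := g.prodMap LinearMap.id) (tr_prod hG hF) hS' ?_ ?_ ?_
    · exact LinearMap.inl_injective.comp hf
    · rintro ⟨s, x⟩
      obtain ⟨y, rfl⟩ := hg s
      exact ⟨(y, x), rfl⟩
    · rintro ⟨y, x⟩
      simp only [LinearMap.prodMap_apply, LinearMap.id_apply, Prod.mk_eq_zero, Set.mem_range,
        LinearMap.comp_apply, LinearMap.inl_apply, Prod.mk.injEq]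
      rw [hfg y]
      constructor
      · rintro ⟨⟨z, rfl⟩, rfl⟩
        exact ⟨z, rfl, rfl⟩
      · rintro ⟨z, rfl, rfl⟩
        exact ⟨⟨z, rfl⟩, rfl⟩

theorem rb_ker (m : ℕ) {T U G : Type u} [AddCommGroup T] [Module R T] [AddCommGroup U] [Module R U]
    [AddCommGroup G] [Module R G] {f : T →ₗ[R] U} {g : U →ₗ[R] G} (hf : Function.Injective f)
    (hg : Function.Surjective g) (h : Function.Exact f g) (hU : RB R m U) (hG : TR R G) :
    RB R m T := by
  cases m with
  | zero => exact rb_zero.2 (tr_ker hf hg h (rb_zero.1 hU) hG)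
  | succ m =>
    obtain ⟨G', S', f', g', hG', hS', hf', hg', hfg'⟩ := rb_succ hU
    have hH : TR R (LinearMap.ker (g ∘ₗ g')) :=
      tr_ker (Submodule.injective_subtype _) (hg.comp hg') (ker_exact (g ∘ₗ g')) hG' hG
    have hT : ∀ x : LinearMap.ker (g ∘ₗ g'), g' x ∈ LinearMap.range f := by
      rintro ⟨x, hx⟩
      exact (h _).1 hx
    let e := LinearEquiv.ofInjective f hf
    let q : LinearMap.ker (g ∘ₗ g') →ₗ[R] T :=
      e.symm.toLinearMap ∘ₗ (g' ∘ₗ (LinearMap.ker (g ∘ₗ g')).subtype).codRestrict _ hT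
    have hq : ∀ x, f (q x) = g' x := by
      intro x
      have := LinearEquiv.apply_symm_apply e
        ((g' ∘ₗ (LinearMap.ker (g ∘ₗ g')).subtype).codRestrict _ hT x)
      exact congrArg Subtype.val this
    have hS2 : ∀ s, f' s ∈ LinearMap.ker (g ∘ₗ g') := by
      intro s
      simp [hfg'.apply_apply_eq_zero s]
    refine rb_succ' (f := f'.codRestrict _ hS2) (g := q) hH hS' ?_ ?_ ?_
    · intro a b hab
      exact hf' (congrArg Subtype.val hab)
    · intro t
      obtain ⟨x, hx⟩ := hg' (f t)
      refine ⟨⟨x, ?_⟩, hf ?_⟩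
      · simp [hx, h.apply_apply_eq_zero t]
      · exact (hq _).trans hx
    · intro x
      constructor
      · intro hx
        have : g' x = 0 := by rw [← hq, hx, map_zero]
        obtain ⟨s, hs⟩ := (hfg' _).1 this
        exact ⟨s, Subtype.ext hs⟩
      · rintro ⟨s, rfl⟩
        apply hf
        rw [hq, map_zero]
        exact hfg'.apply_apply_eq_zero s

theorem rb_syz (m : ℕ) {K F : Type u} [AddCommGroup K] [Module R K] [AddCommGroup F] [Module R F]
    [Module.Finite R F] [Module.Projective R F] (p : F →ₗ[R] K) (hp : Function.Surjective p)
    (hK : RB R (m + 1) K) : RB R m (LinearMap.ker p) := by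
  obtain ⟨G, S, f, g, hG, hS, hf, hg, hfg⟩ := rb_succ hK
  obtain ⟨l, hl⟩ := Module.projective_lifting_property g p hg
  have hl' : ∀ x, g (l x) = p x := fun x => LinearMap.congr_fun hl x
  have hU := rb_prod m F tr_free S hS
  have hT : ∀ x : LinearMap.ker p, l x ∈ LinearMap.range f := by
    rintro ⟨x, hx⟩
    refine (hfg _).1 ?_
    rw [hl']
    exact hx
  let e := LinearEquiv.ofInjective f hf
  let q : LinearMap.ker p →ₗ[R] S :=
    e.symm.toLinearMap ∘ₗ (l ∘ₗ (LinearMap.ker p).subtype).codRestrict _ hT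
  have hq : ∀ x, f (q x) = l x := by
    intro x
    have := LinearEquiv.apply_symm_apply e ((l ∘ₗ (LinearMap.ker p).subtype).codRestrict _ hT x)
    exact congrArg Subtype.val this
  refine rb_ker m (f := q.prod (LinearMap.ker p).subtype)
    (g := (-f).coprod l) ?_ ?_ ?_ hU hG
  · intro a b hab
    exact Subtype.ext (congrArg Prod.snd hab)
  · intro y
    obtain ⟨x, hx⟩ := hp (g y)
    have : g (l x - y) = 0 := by rw [map_sub, hl', hx, sub_self]
    obtain ⟨s, hs⟩ := (hfg _).1 this
    refine ⟨(s, x), ?_⟩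
    simp [hs]
  · rintro ⟨s, x⟩
    constructor
    · intro h
      have h' : f s = l x := by
        simp only [LinearMap.coprod_apply, LinearMap.neg_apply] at h
        rw [neg_add_eq_zero] at h
        exact h
      have hx : p x = 0 := by rw [← hl', ← h', hfg.apply_apply_eq_zero]
      refine ⟨⟨x, hx⟩, ?_⟩
      refine Prod.ext (hf ?_) rfl
      exact (hq _).trans h'.symm
    · rintro ⟨x, hx⟩
      rw [← hx]
      simp [hq]

/-- iterated kernels of free covers are totally reflexive -/
def QQ (R : Type u) [CommRing R] : ℕ → ModuleCat.{u} R → Prop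
  | 0, M => TR R M
  | m + 1, M => ∃ (n : ℕ) (p : (Fin n → R) →ₗ[R] M), Function.Surjective p ∧
      QQ R m (ModuleCat.of R (LinearMap.ker p))

theorem qq_of_retract [IsNoetherianRing R] (m : ℕ) : ∀ (M K : Type u) [AddCommGroup M] [Module R M]
    [AddCommGroup K] [Module R K] [Module.Finite R M] [Module.Finite R K] (s : M →ₗ[R] K)
    (r : K →ₗ[R] M) (_ : r ∘ₗ s = LinearMap.id) (_ : RB R m K), QQ R m (ModuleCat.of R M) := by
  induction m with
  | zero =>
    intro M K _ _ _ _ _ _ s r h hK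
    exact tr_retract s r h (rb_zero.1 hK)
  | succ m ih =>
    intro M K _ _ _ _ _ _ s r h hK
    have h' : ∀ x, r (s x) = x := fun x => LinearMap.congr_fun h x
    obtain ⟨n, p, hp⟩ := Module.Finite.exists_fin' R M
    obtain ⟨n', q, hq⟩ := Module.Finite.exists_fin' R K
    obtain ⟨l, hl⟩ := Module.projective_lifting_property p (r ∘ₗ q) hp
    have hl' : ∀ x, p (l x) = r (q x) := fun x => LinearMap.congr_fun hl x
    let P : ((Fin n → R) × (Fin n' → R)) →ₗ[R] K := (s ∘ₗ p).coprod q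
    have hP : Function.Surjective P := by
      intro x
      obtain ⟨y, rfl⟩ := hq x
      exact ⟨(0, y), by simp [P]⟩
    refine ⟨n, p, hp, ?_⟩
    have h1 : ∀ x : LinearMap.ker p, LinearMap.inl R (Fin n → R) (Fin n' → R) x ∈ LinearMap.ker P := by
      rintro ⟨x, hx⟩
      have hx : p x = 0 := hx
      simp [P, hx]
    have h2 : ∀ x : LinearMap.ker P, (LinearMap.id.coprod l) x.1 ∈ LinearMap.ker p := by
      rintro ⟨⟨x, y⟩, hx⟩
      have hx : s (p x) + q y = 0 := by simpa [P] using hx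
      have := congrArg r hx
      simp only [map_add, h', map_zero] at this
      simp [hl', this]
    refine ih (LinearMap.ker p) (LinearMap.ker P)
      ((LinearMap.inl R (Fin n → R) (Fin n' → R) ∘ₗ (LinearMap.ker p).subtype).codRestrict _ h1)
      (((LinearMap.id.coprod l) ∘ₗ (LinearMap.ker P).subtype).codRestrict _ h2) ?_ (rb_syz m P hP hK)
    refine LinearMap.ext fun x => Subtype.ext ?_
    change (x : Fin n → R) + l 0 = x
    simp

end Resolved
end SDZ
namespace SDZ

section Depth
variable {R : Type u} [CommRing R] [IsNoetherianRing R] [IsLocalRing R]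
variable {M N : Type u} [AddCommGroup M] [Module R M] [AddCommGroup N] [Module R N]

open IsLocalRing

/-- depth at least `d` -/
abbrev DP (R : Type u) [CommRing R] [IsLocalRing R] (d : ℕ) (M : Type u) [AddCommGroup M]
    [Module R M] : Prop := ∀ j < d, EZ R (R ⧸ maximalIdeal R) M j

theorem dp_free {d : ℕ} (hd : DP R d R) (n : ℕ) : DP R d (Fin n → R) := by
  intro j hj
  have h : EZ R (R ⧸ maximalIdeal R) ((Fin n → R) →ₗ[R] R) j :=
    ez_hom j (fun i hi => hd i (by omega)) (Fin n → R) (fun i => ez_proj _ _ i)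
  let e : (Fin n → R) ≃ₗ[R] ((Fin n → R) →ₗ[R] R) := (Pi.basisFun R (Fin n)).toDualEquiv
  exact ez_cov_retract e.toLinearMap e.symm.toLinearMap (by ext; simp) h

theorem pf_inj_of_conj {A B A' B' X : Type u} [AddCommGroup A] [Module R A] [AddCommGroup B]
    [Module R B] [AddCommGroup A'] [Module R A'] [AddCommGroup B'] [Module R B'] [AddCommGroup X]
    [Module R X] (a : A ≃ₗ[R] A') (b : B ≃ₗ[R] B') (f : A →ₗ[R] B) (f' : A' →ₗ[R] B') (t : ℕ)
    (hab : f' ∘ₗ a.toLinearMap = b.toLinearMap ∘ₗ f) (h : Function.Injective (pf X f t)) :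
    Function.Injective (pf X f' t) := by
  rw [injective_iff_map_eq_zero]
  intro α hα
  have h1 : pf X b.toLinearMap t (pf X f t (pf X a.symm.toLinearMap t α)) = 0 := by
    rw [pf_comp, pf_comp, ← hab]
    have : (f' ∘ₗ a.toLinearMap) ∘ₗ a.symm.toLinearMap = f' := by ext; simp
    rw [this, hα]
  have h2 := congrArg (pf X b.symm.toLinearMap t) h1
  rw [pf_comp, map_zero] at h2
  have : b.symm.toLinearMap ∘ₗ b.toLinearMap = LinearMap.id := by ext; simp
  rw [this, pf_id] at h2
  have h3 : pf X a.symm.toLinearMap t α = 0 := h (by rw [h2, map_zero])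
  have h4 := congrArg (pf X a.toLinearMap t) h3
  rw [pf_comp, map_zero] at h4
  have : a.toLinearMap ∘ₗ a.symm.toLinearMap = LinearMap.id := by ext; simp
  rwa [this, pf_id] at h4

theorem tr_of_cover {d : ℕ} (hd : DP R d R) (hnd : ¬ EZ R (R ⧸ maximalIdeal R) R d)
    (hM : DP R d M) {n : ℕ} (p : (Fin n → R) →ₗ[R] M) (hp : Function.Surjective p)
    (hS : TR R (LinearMap.ker p)) : TR R M := by
  refine tr_coker (Submodule.injective_subtype _) hp (ker_exact p) hS tr_free ?_
  set j := (LinearMap.ker p).subtype with hj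
  by_contra hns
  have hU : LinearMap.range (LinearMap.lcomp R R j) ≠ ⊤ := fun h => hns (LinearMap.range_eq_top.1 h)
  obtain ⟨π, hπ, hπU⟩ := exists_surj_res _ hU
  obtain ⟨e, he⟩ : ∃ e : Abelian.Ext (ModuleCat.of R (R ⧸ maximalIdeal R)) (ModuleCat.of R R) d,
      e ≠ 0 := by
    by_contra hcon
    push Not at hcon
    exact hnd (subsingleton_of_forall_eq 0 hcon)
  obtain ⟨φ, hφ⟩ := exists_res_hom (fun r hr x => ext_killed (maximalIdeal R) r hr d x) e
  obtain ⟨α, hα⟩ := Phi_surj (X := R ⧸ maximalIdeal R) (N := R) d hd hS.evd (φ ∘ₗ π)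
  have hF : TR R (Fin n → R) := tr_free
  have h0 : pf (R ⧸ maximalIdeal R) (LinearMap.lcomp R R (LinearMap.lcomp R R j)) d α = 0 := by
    apply Phi_inj d hd hF.evd
    rw [Phi_nat, hα, map_zero]
    ext1 x
    simp only [LinearMap.comp_apply, LinearMap.zero_apply]
    rw [hπU _ ⟨x, rfl⟩, map_zero]
  have hinj : Function.Injective
      (pf (R ⧸ maximalIdeal R) (LinearMap.lcomp R R (LinearMap.lcomp R R j)) d) := by
    refine pf_inj_of_conj (LinearEquiv.ofBijective _ hS.bij) (LinearEquiv.ofBijective _ hF.bij)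
      j _ d rfl ?_
    exact pf_inj (Submodule.injective_subtype _) hp (ker_exact p) d hM
  have hα0 : α = 0 := hinj (by rw [h0, map_zero])
  rw [hα0, map_zero] at hα
  obtain ⟨x, hx⟩ := hπ (Ideal.Quotient.mk _ 1)
  have := LinearMap.congr_fun hα x
  rw [LinearMap.comp_apply, hx, hφ] at this
  exact he this.symm

theorem tr_of_qq {d : ℕ} (hd : DP R d R) (hnd : ¬ EZ R (R ⧸ maximalIdeal R) R d) (m : ℕ) :
    ∀ (M : Type u) [AddCommGroup M] [Module R M], DP R d M → QQ R m (ModuleCat.of R M) →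
      TR R M := by
  induction m with
  | zero => intro M _ _ _ h; exact h
  | succ m ih =>
    rintro M _ _ hM ⟨n, p, hp, h⟩
    refine tr_of_cover hd hnd hM p hp (ih _ ?_ h)
    intro j hj
    exact ez_cov_left (Submodule.injective_subtype _) hp (ker_exact p) j
      (fun i hi => hM i (by omega)) (dp_free hd n j hj)

variable {C : Type u} [AddCommGroup C] [Module R C] [Module.Finite R C]

theorem nontriv_of_lsmul (hbij : Function.Bijective (LinearMap.lsmul R C)) : Nontrivial C := by
  by_contra h
  rw [not_nontrivial_iff_subsingleton] at h
  have : (1 : R) = 0 := hbij.1 (by ext; exact Subsingleton.elim _ _)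
  exact one_ne_zero this

/-- the comparison map in the self-dual case -/
theorem dp_semidualizing {d : ℕ} (hd : DP R d R)
    (hbij : Function.Bijective (LinearMap.lsmul R C)) (hC : EV R C C) : DP R d C := by
  have hnt := nontriv_of_lsmul hbij
  intro j
  induction j using Nat.strong_induction_on with
  | _ j ih =>
  intro hj
  have h1 : EZ R (R ⧸ maximalIdeal R) (C →ₗ[R] C) j := by
    let e : R ≃ₗ[R] (C →ₗ[R] C) := LinearEquiv.ofBijective _ hbij
    exact ez_cov_retract e.symm.toLinearMap e.toLinearMap (by ext1; simp) (hd j hj)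
  have h2 := (Phi_surj (X := R ⧸ maximalIdeal R) (M := C) (N := C) j
    (fun i hi => ih i hi (by omega)) hC).subsingleton
  refine subsingleton_of_forall_eq 0 fun e => ?_
  obtain ⟨φ, hφ⟩ := exists_res_hom (fun r hr x => ext_killed (maximalIdeal R) r hr j x) e
  obtain ⟨π, hπ, -⟩ := exists_surj_res (⊥ : Submodule R C) bot_ne_top
  obtain ⟨x, hx⟩ := hπ (Ideal.Quotient.mk _ 1)
  have h3 : φ ∘ₗ π = 0 := Subsingleton.elim _ _
  have := LinearMap.congr_fun h3 x
  rw [LinearMap.comp_apply, hx, hφ] at this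
  exact this

end Depth
end SDZ
namespace SDZ

section Final
variable {R : Type u} [CommRing R]

/-- functoriality for isomorphisms -/
noncomputable def pfE (X : Type u) [AddCommGroup X] [Module R X] {A B : Type u} [AddCommGroup A]
    [Module R A] [AddCommGroup B] [Module R B] (e : A ≃ₗ[R] B) (t : ℕ) :
    Abelian.Ext (ModuleCat.of R X) (ModuleCat.of R A) t ≃ₗ[R]
      Abelian.Ext (ModuleCat.of R X) (ModuleCat.of R B) t :=
  LinearEquiv.ofLinear (pf X e.toLinearMap t) (pf X e.symm.toLinearMap t)
    (by
      refine LinearMap.ext fun α => ?_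
      have : e.toLinearMap ∘ₗ e.symm.toLinearMap = LinearMap.id := by ext; simp
      rw [LinearMap.comp_apply, pf_comp, this, pf_id]; rfl)
    (by
      refine LinearMap.ext fun α => ?_
      have : e.symm.toLinearMap ∘ₗ e.toLinearMap = LinearMap.id := by ext; simp
      rw [LinearMap.comp_apply, pf_comp, this, pf_id]; rfl)

variable [IsNoetherianRing R] [IsLocalRing R]

open IsLocalRing

theorem exists_resE {E : Type*} [AddCommGroup E] [Module R E]
    (hE : ∀ r ∈ maximalIdeal R, ∀ e : E, r • e = 0) :
    ∃ j : E →ₗ[R] ((R ⧸ maximalIdeal R) →ₗ[R] E), ∀ e, j e (Ideal.Quotient.mk _ 1) = e := by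
  let ev : ((R ⧸ maximalIdeal R) →ₗ[R] E) →ₗ[R] E := LinearMap.applyₗ (Ideal.Quotient.mk _ 1)
  have hev : Function.Bijective ev := by
    constructor
    · intro a b hab
      refine LinearMap.ext fun x => ?_
      obtain ⟨y, rfl⟩ := Ideal.Quotient.mk_surjective x
      have h1 : Ideal.Quotient.mk (maximalIdeal R) y = y • Ideal.Quotient.mk (maximalIdeal R) 1 := by
        rw [Algebra.smul_def]; simp
      rw [h1, map_smul, map_smul]
      exact congrArg (y • ·) hab
    · intro e
      exact exists_res_hom hE e
  refine ⟨(LinearEquiv.ofBijective ev hev).symm.toLinearMap, fun e => ?_⟩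
  exact (LinearEquiv.ofBijective ev hev).apply_symm_apply e

variable {C : Type u} [AddCommGroup C] [Module R C] [Module.Finite R C]

theorem free_of_tr (hbij : Function.Bijective (LinearMap.lsmul R C)) (hC : EV R C C)
    (hT : TR R C) : Nonempty (C ≃ₗ[R] R) := by
  obtain ⟨d, hnd, hd⟩ := exists_depth (R := R)
  have hdC : DP R d C := dp_semidualizing hd hbij hC
  have hnt := nontriv_of_lsmul hbij
  have hnt' : Nontrivial (C →ₗ[R] R) := by
    by_contra h
    rw [not_nontrivial_iff_subsingleton] at h
    have h2 : Subsingleton ((C →ₗ[R] R) →ₗ[R] R) :=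
      ⟨fun a b => LinearMap.ext fun x => by rw [Subsingleton.elim x 0, map_zero, map_zero]⟩
    exact not_subsingleton C (Function.Injective.subsingleton hT.bij.1)
  set k := R ⧸ maximalIdeal R with hk
  let ER := Abelian.Ext (ModuleCat.of R k) (ModuleCat.of R R) d
  let EC := Abelian.Ext (ModuleCat.of R k) (ModuleCat.of R C) d
  obtain ⟨jR, hjR⟩ := exists_resE (R := R) (E := ER)
    (fun r hr x => ext_killed (maximalIdeal R) r hr d x)
  obtain ⟨jC, hjC⟩ := exists_resE (R := R) (E := EC)
    (fun r hr x => ext_killed (maximalIdeal R) r hr d x)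
  -- `Hom(C, EC) ≅ ER`
  let e1 : ER ≃ₗ[R] (C →ₗ[R] EC) := (pfE k (LinearEquiv.ofBijective _ hbij) d).trans
    (LinearEquiv.ofBijective (Phi k C C d) ⟨Phi_inj d hdC hC, Phi_surj d hdC hC⟩)
  -- `EC ≅ Hom(C^*, ER)`
  let e2 : EC ≃ₗ[R] ((C →ₗ[R] R) →ₗ[R] ER) := (pfE k (LinearEquiv.ofBijective _ hT.bij) d).trans
    (LinearEquiv.ofBijective (Phi k (C →ₗ[R] R) R d) ⟨Phi_inj d hd hT.evd, Phi_surj d hd hT.evd⟩)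
  -- `ER ↪ EC`
  obtain ⟨π, hπ, -⟩ := exists_surj_res (⊥ : Submodule R (C →ₗ[R] R)) bot_ne_top
  let i1 : ER →ₗ[R] EC := e2.symm.toLinearMap ∘ₗ LinearMap.lcomp R ER π ∘ₗ jR
  have hi1 : Function.Injective i1 := by
    refine e2.symm.injective.comp ((lcomp_inj hπ).comp ?_)
    intro a b hab
    rw [← hjR a, ← hjR b, hab]
  obtain ⟨π1, hπ1, -⟩ := exists_surj_res (⊥ : Submodule R C) bot_ne_top
  obtain ⟨x, hx⟩ := hπ1 (Ideal.Quotient.mk _ 1)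
  by_cases hU : Submodule.span R {x} = ⊤
  · refine ⟨(LinearEquiv.ofBijective (LinearMap.toSpanSingleton R C x) ⟨?_, ?_⟩).symm⟩
    · rw [injective_iff_map_eq_zero]
      intro r hr
      have hr : r • x = 0 := by simpa using hr
      apply hbij.1
      rw [map_zero]
      ext y
      obtain ⟨s, rfl⟩ := Submodule.mem_span_singleton.1 (hU ▸ Submodule.mem_top : y ∈ _)
      simp [smul_comm r s, hr]
    · intro y
      obtain ⟨s, rfl⟩ := Submodule.mem_span_singleton.1 (hU ▸ Submodule.mem_top : y ∈ _)
      exact ⟨s, by simp⟩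
  · exfalso
    obtain ⟨π2, hπ2, hπU⟩ := exists_surj_res _ hU
    obtain ⟨y, hy⟩ := hπ2 (Ideal.Quotient.mk _ 1)
    have hx2 : π2 x = 0 := hπU x (Submodule.mem_span_singleton_self x)
    let i2 : EC × EC →ₗ[R] (C →ₗ[R] EC) :=
      (LinearMap.lcomp R EC π1 ∘ₗ jC).coprod (LinearMap.lcomp R EC π2 ∘ₗ jC)
    have hi2 : Function.Injective i2 := by
      rw [injective_iff_map_eq_zero]
      rintro ⟨a, b⟩ hab
      have h1 : ∀ z, jC a (π1 z) + jC b (π2 z) = 0 := fun z => LinearMap.congr_fun hab z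
      have ha : a = 0 := by
        have := h1 x
        rwa [hx, hx2, hjC, map_zero, add_zero] at this
      have hb : b = 0 := by
        have := h1 y
        rwa [hy, hjC, ha, map_zero, LinearMap.zero_apply, zero_add] at this
      rw [ha, hb]; rfl
    have : Module.Finite R EC := ModuleCat.finite_ext _ _ _ _
    have hs : Subsingleton EC := IsNoetherian.subsingleton_of_prod_injective
      (i1 ∘ₗ e1.symm.toLinearMap ∘ₗ i2) (hi1.comp (e1.symm.injective.comp hi2))
    exact hnd hi1.subsingleton

end Final

section Reduce
variable {R : Type u} [CommRing R]

theorem ev_pi {K N : Type u} [AddCommGroup K] [Module R K] [AddCommGroup N] [Module R N]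
    (h : EV R K N) (n : ℕ) : EV R (Fin n → K) N := by
  induction n with
  | zero =>
    intro i
    refine ez_retract (B := K) 0 0 ?_ (h i)
    exact LinearMap.ext fun x => Subsingleton.elim _ _
  | succ n ih =>
    intro i
    refine ez_equiv (Fin.consLinearEquiv R (fun _ => K)).symm ?_
    exact ez_mid (f := LinearMap.inl R K (Fin n → K)) (g := LinearMap.snd R K (Fin n → K))
      LinearMap.inl_injective LinearMap.snd_surjective Function.Exact.inl_snd (h i) (ih i)

theorem ev_syz {N : Type u} [AddCommGroup N] [Module R N] (n : ℕ) :
    ∀ S K : ModuleCat.{u} R, IsSyzygy R n S K → EV R K N → EV R S N := by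
  induction n with
  | zero =>
    rintro S K ⟨e⟩ h i
    exact ez_equiv e (h i)
  | succ n ih =>
    rintro S K ⟨T, F, hT, ⟨_, _⟩, f, g, hf, hg, hfg⟩ h
    exact ev_ker hf hg (exact_of_ses hfg) (fun i => ez_proj _ _ i) (ih T K hT h)

theorem retract_of_reducing {r : ℕ} (K : Fin (r + 1) → ModuleCat.{u} R) (hK : IsReducingSeq R K)
    (h0 : EV R (K 0) (K 0)) (i : Fin (r + 1)) : EV R (K i) (K 0) ∧
      ∃ (s : K 0 →ₗ[R] K i) (t : K i →ₗ[R] K 0), t ∘ₗ s = LinearMap.id := by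
  obtain ⟨-, a, b, n, ha, -, -, h⟩ := hK
  induction i using Fin.induction with
  | zero => exact ⟨h0, LinearMap.id, LinearMap.id, rfl⟩
  | succ i ih =>
    obtain ⟨hev, s, t, hst⟩ := ih
    obtain ⟨S, hS, f, g, hf, hg, hfg⟩ := h i
    have hSev : EV R S (K 0) := ev_syz _ _ _ hS (ev_pi hev (b i))
    let f' : (Fin (a i) → K i.castSucc) →ₗ[R] K i.succ := f
    have hfg' : Function.Exact f' g := exact_of_ses hfg
    let z : Fin (a i) := ⟨0, ha i⟩
    refine ⟨fun j => ez_mid (f := f') hf hg hfg' (ev_pi hev (a i) j) (hSev j), ?_⟩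
    obtain ⟨ψ, hψ⟩ := hom_lift (f := f') hf hg hfg' (hSev 0) (t ∘ₗ LinearMap.proj z)
    refine ⟨f' ∘ₗ LinearMap.single R (fun _ => (K i.castSucc : Type u)) z ∘ₗ s, ψ, ?_⟩
    rw [← LinearMap.comp_assoc, hψ, ← hst]
    ext x
    simp

end Reduce
end SDZ

theorem semidualizing_tfae
    (R : Type u) [CommRing R] [IsNoetherianRing R] [IsLocalRing R]
    (C : ModuleCat.{u} R) (hC : Module.Finite R C)
    (hbij : Function.Bijective (LinearMap.lsmul R (C : Type u)))
    (hext : ∀ i : ℕ, 1 ≤ i → ExtVanishes R C C i) :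
    (Nonempty ((C : Type u) ≃ₗ[R] R) ↔ IsTotallyReflexive R C) ∧
    (IsTotallyReflexive R C ↔ FiniteGdim R C) ∧
    (FiniteGdim R C ↔ FiniteRedGdim R C) := by
  have hEV : SDZ.EV R C C := fun i => (SDZ.extVanishes_iff C C i).1 (hext (i + 1) (by omega))
  have h12 : Nonempty ((C : Type u) ≃ₗ[R] R) → IsTotallyReflexive R C := by
    rintro ⟨e⟩
    exact (SDZ.tr_iff C).2 (SDZ.tr_equiv e SDZ.tr_free)
  have h23 : IsTotallyReflexive R C → FiniteGdim R C := fun h =>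
    ⟨0, C, h, ⟨LinearEquiv.refl R C⟩⟩
  have h34 : FiniteGdim R C → FiniteRedGdim R C := fun h =>
    ⟨0, fun _ => C, rfl, ⟨fun _ => hC, fun _ => 0, fun _ => 0, fun _ => 0, fun i => i.elim0,
      fun i => i.elim0, fun i => i.elim0, fun i => i.elim0⟩, h⟩
  have h41 : FiniteRedGdim R C → Nonempty ((C : Type u) ≃ₗ[R] R) := by
    rintro ⟨r, K, rfl, hK, m, hm⟩
    obtain ⟨-, s, t, hst⟩ := SDZ.retract_of_reducing K hK hEV (Fin.last r)
    have := hK.1 (Fin.last r)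
    obtain ⟨d, hnd, hd⟩ := SDZ.exists_depth (R := R)
    have hq : SDZ.QQ R m (ModuleCat.of R (K 0)) := SDZ.qq_of_retract m _ _ s t hst hm
    have hT : SDZ.TR R (K 0) :=
      SDZ.tr_of_qq hd hnd m _ (SDZ.dp_semidualizing hd hbij hEV) hq
    exact SDZ.free_of_tr hbij hEV hT
  tauto
end

section
/- Let (R, m, k) be a commutative Noetherian local ring with m² = 0, and let M be a finitely generated R-module with finite reducing projective dimension, i.e., M admits a reducing sequence K_0 = M, K_1, …, K_r in which K_r has finite projective dimension. Then M ≅ R^{⊕α} ⊕ k^{⊕β} for some integers α, β ≥ 0. -/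
open CategoryTheory

universe u

variable (R : Type u) [CommRing R]

open TensorProduct in
/-- Over a local ring with `m² = 0`, `m ≠ 0`, an injection of finite free modules
stays injective modulo `m`. -/
theorem aux_lTensor_inj {R : Type u} [CommRing R] [IsLocalRing R]
    (hm2 : (IsLocalRing.maximalIdeal R) ^ 2 = ⊥) (s : R) (hs : s ∈ IsLocalRing.maximalIdeal R)
    (hs0 : s ≠ 0) {T F : Type u} [AddCommGroup T] [Module R T] [AddCommGroup F] [Module R F]
    [Module.Finite R T] [Module.Free R T] [Module.Finite R F] [Module.Free R F]
    (l : T →ₗ[R] F) (hl : Function.Injective l) :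
    Function.Injective (l.lTensor (IsLocalRing.ResidueField R)) := by
  have key : ∀ a ∈ IsLocalRing.maximalIdeal R, ∀ b ∈ IsLocalRing.maximalIdeal R, a * b = 0 := by
    intro a ha b hb
    have h : a * b ∈ (IsLocalRing.maximalIdeal R) ^ 2 := by
      rw [pow_two]; exact Ideal.mul_mem_mul ha hb
    rw [hm2] at h
    simpa using h
  rw [injective_iff_map_eq_zero]
  intro x hx
  obtain ⟨t, rfl⟩ := TensorProduct.mk_surjective R T (IsLocalRing.ResidueField R)
    Ideal.Quotient.mk_surjective x
  simp only [TensorProduct.mk_apply, LinearMap.lTensor_tmul] at hx ⊢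
  let bF := Module.Free.chooseBasis R F
  let bT := Module.Free.chooseBasis R T
  have h1 : ∀ i, bF.repr (l t) i ∈ IsLocalRing.maximalIdeal R := by
    intro i
    have h2 := congrArg ((TensorProduct.rid R (IsLocalRing.ResidueField R)) ∘
      ((bF.coord i).lTensor (IsLocalRing.ResidueField R))) hx
    simp only [Function.comp, LinearMap.lTensor_tmul, TensorProduct.rid_tmul, map_zero,
      Module.Basis.coord_apply] at h2
    rw [← IsLocalRing.residue_eq_zero_iff]
    rw [Algebra.smul_def, mul_one] at h2
    exact h2
  have h3 : s • t = 0 := by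
    apply hl
    rw [map_zero, map_smul]
    apply bF.repr.injective
    ext i
    simp [key s hs _ (h1 i)]
  have h4 : ∀ i, bT.repr t i ∈ IsLocalRing.maximalIdeal R := by
    intro i
    by_contra hu
    rw [IsLocalRing.notMem_maximalIdeal] at hu
    have h5 : s * bT.repr t i = 0 := by
      have := congrArg (fun z => bT.repr z i) h3
      simpa using this
    exact hs0 (hu.mul_left_eq_zero.mp h5)
  rw [← bT.sum_repr t, TensorProduct.tmul_sum]
  refine Finset.sum_eq_zero fun i _ => ?_
  rw [← TensorProduct.smul_tmul]
  have h6 : (bT.repr t i) • (1 : IsLocalRing.ResidueField R) = 0 := by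
    rw [Algebra.smul_def, mul_one]
    exact (IsLocalRing.residue_eq_zero_iff _).mpr (h4 i)
  rw [h6, TensorProduct.zero_tmul]

open TensorProduct in
theorem aux_free_of_max_bot {R : Type u} [CommRing R] [IsNoetherianRing R] [IsLocalRing R]
    (h : IsLocalRing.maximalIdeal R = ⊥) (N : Type u) [AddCommGroup N] [Module R N]
    [Module.Finite R N] : Module.Free R N := by
  have : Module.FinitePresentation R N := Module.finitePresentation_of_finite R N
  apply Module.free_of_maximalIdeal_rTensor_injective
  have : Subsingleton (IsLocalRing.maximalIdeal R) := by rw [h]; infer_instance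
  have : Subsingleton ((IsLocalRing.maximalIdeal R) ⊗[R] N) := inferInstance
  exact Function.injective_of_subsingleton _

theorem aux_free_of_pd {R : Type u} [CommRing R] [IsNoetherianRing R] [IsLocalRing R]
    (hm2 : (IsLocalRing.maximalIdeal R) ^ 2 = ⊥) (n : ℕ) :
    ∀ (N : ModuleCat.{u} R), Module.Finite R N → HasProjectiveDimensionLT N (n + 1) →
      Module.Free R N := by
  induction n with
  | zero =>
    intro N hN hp
    have h1 : Projective N := projective_iff_hasProjectiveDimensionLT_one.mpr hp
    have h2 : Module.Projective R N := (IsProjective.iff_projective N).mpr h1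
    exact Module.free_of_flat_of_isLocalRing
  | succ n ih =>
    intro N hN hp
    by_cases hbot : IsLocalRing.maximalIdeal R = ⊥
    · exact aux_free_of_max_bot hbot N
    obtain ⟨s, hs, hs0⟩ := Submodule.exists_mem_ne_zero_of_ne_bot hbot
    obtain ⟨d, g, hg⟩ := Module.Finite.exists_fin' R N
    have hex : Function.Exact (LinearMap.ker g).subtype g := LinearMap.exact_subtype_ker_map g
    -- the universe-adjusted short exact sequence
    let S : ShortComplex (ModuleCat.{u} R) :=
      ShortComplex.mk (ModuleCat.ofHom (LinearMap.ker g).subtype) (ModuleCat.ofHom g)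
        (by ext x; exact x.2)
    have hS : S.ShortExact :=
      { exact := (ShortComplex.ShortExact.moduleCat_exact_iff_function_exact S).mpr hex
        mono_f := (ModuleCat.mono_iff_injective _).mpr Subtype.val_injective
        epi_g := (ModuleCat.epi_iff_surjective _).mpr hg }
    have hproj : Projective S.X₂ := (IsProjective.iff_projective (Fin d → R)).mp inferInstance
    have hT := (hS.hasProjectiveDimensionLT_X₃_iff n hproj).mp hp
    have hfree : Module.Free R (LinearMap.ker g) := ih S.X₁ inferInstance hT
    exact Module.free_of_lTensor_residueField_injective _ _ hg hex
      (aux_lTensor_inj hm2 s hs hs0 _ Subtype.val_injective)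

theorem aux_pd_of_resolved {R : Type u} [CommRing R] (n : ℕ) :
    ∀ (N : ModuleCat.{u} R), ResolvedBy R (fun G => Module.Projective R G) n N →
      HasProjectiveDimensionLT N (n + 1) := by
  induction n with
  | zero =>
    rintro N ⟨G, hG, ⟨e⟩⟩
    have : Module.Projective R N := Module.Projective.of_equiv e
    have h1 : Projective N := (IsProjective.iff_projective N).mp this
    exact projective_iff_hasProjectiveDimensionLT_one.mp h1
  | succ n ih =>
    rintro N ⟨G, S', hG, ⟨f, g, hf, hg, hfg⟩, hr⟩
    have hex : Function.Exact f g := LinearMap.exact_iff.mpr hfg.symm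
    let S : ShortComplex (ModuleCat.{u} R) :=
      ShortComplex.mk (ModuleCat.ofHom f) (ModuleCat.ofHom g)
        (by ext x; exact hex.apply_apply_eq_zero x)
    have hS : S.ShortExact :=
      { exact := (ShortComplex.ShortExact.moduleCat_exact_iff_function_exact S).mpr hex
        mono_f := (ModuleCat.mono_iff_injective _).mpr hf
        epi_g := (ModuleCat.epi_iff_surjective _).mpr hg }
    have hproj : Projective S.X₂ := (IsProjective.iff_projective G).mp hG
    exact (hS.hasProjectiveDimensionLT_X₃_iff n hproj).mpr (ih S' hr)

/-- A finite module killed by the maximal ideal is a vector space. -/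
theorem aux_torsion {R : Type u} [CommRing R] [IsLocalRing R]
    (N : Type u) [AddCommGroup N] [Module R N] [Module.Finite R N]
    (h : ∀ a ∈ IsLocalRing.maximalIdeal R, ∀ x : N, a • x = 0) :
    ∃ β : ℕ, Nonempty (N ≃ₗ[R] (Fin β → IsLocalRing.ResidueField R)) := by
  have ht : Module.IsTorsionBySet R N (IsLocalRing.maximalIdeal R : Set R) :=
    fun x a => h a.1 a.2 x
  let : Module (IsLocalRing.ResidueField R) N := ht.module
  have : IsScalarTower R (IsLocalRing.ResidueField R) N := ht.isScalarTower
  have : Module.Finite (IsLocalRing.ResidueField R) N :=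
    Module.Finite.of_restrictScalars_finite R _ N
  exact ⟨_, ⟨(Module.finBasis (IsLocalRing.ResidueField R) N).equivFun.restrictScalars R⟩⟩

theorem aux_sub {R : Type u} [CommRing R] [IsNoetherianRing R] [IsLocalRing R]
    (hm2 : (IsLocalRing.maximalIdeal R) ^ 2 = ⊥) (n : ℕ) :
    ∀ (N : Type u) [AddCommGroup N] [Module R N] [Module.Finite R N]
      (j : N →ₗ[R] (Fin n → R)), Function.Injective j →
      ∃ α β : ℕ, Nonempty (N ≃ₗ[R] (Fin α → R) × (Fin β → IsLocalRing.ResidueField R)) := by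
  have key : ∀ a ∈ IsLocalRing.maximalIdeal R, ∀ b ∈ IsLocalRing.maximalIdeal R, a * b = 0 := by
    intro a ha b hb
    have h : a * b ∈ (IsLocalRing.maximalIdeal R) ^ 2 := by
      rw [pow_two]; exact Ideal.mul_mem_mul ha hb
    rw [hm2] at h
    simpa using h
  induction n with
  | zero =>
    intro N _ _ _ j hj
    have : Subsingleton N := hj.subsingleton
    obtain ⟨β, ⟨e⟩⟩ := aux_torsion (R := R) N (fun a _ x => Subsingleton.elim _ _)
    exact ⟨0, β, ⟨e.trans (LinearEquiv.uniqueProd).symm⟩⟩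
  | succ n ih =>
    intro N _ _ _ j hj
    by_cases hu : ∃ i x, IsUnit (j x i)
    · obtain ⟨i, x, hx⟩ := hu
      let f : N →ₗ[R] R := (LinearMap.proj i).comp j
      obtain ⟨u, hu⟩ := hx
      have hfx : f ((↑u⁻¹ : R) • x) = 1 := by simp [f, ← hu]
      let sec : R →ₗ[R] N := LinearMap.toSpanSingleton R N ((↑u⁻¹ : R) • x)
      have hsec : ∀ r, f (sec r) = r := by
        intro r
        simp only [sec, LinearMap.toSpanSingleton_apply]
        rw [map_smul, hfx, smul_eq_mul, mul_one]
      let j' : LinearMap.ker f →ₗ[R] (Fin n → R) :=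
        (LinearMap.funLeft R R i.succAbove).comp (j.comp (LinearMap.ker f).subtype)
      have hj' : Function.Injective j' := by
        rw [injective_iff_map_eq_zero]
        intro y hy
        apply Subtype.ext
        apply hj
        rw [Submodule.coe_zero, map_zero]
        ext k
        rcases Fin.eq_self_or_eq_succAbove i k with rfl | ⟨k', rfl⟩
        · exact y.2
        · exact congrFun hy k'
      obtain ⟨α, β, ⟨e⟩⟩ := ih (LinearMap.ker f) j' hj'
      let e0 : N ≃ₗ[R] R × LinearMap.ker f :=
        LinearEquiv.ofLinearMap
          (f.prod ((LinearMap.id - sec.comp f).codRestrict (LinearMap.ker f)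
            (fun y => by simp [hsec])))
          (sec.coprod (LinearMap.ker f).subtype)
          (by
            apply LinearMap.ext
            rintro ⟨r, y⟩
            have hy : f y = 0 := y.2
            refine Prod.ext ?_ (Subtype.ext ?_)
            · simp [hsec]
            · simp [hsec])
          (by ext y; simp)
      refine ⟨α + 1, β, ⟨e0.trans (((LinearEquiv.refl R R).prodCongr e).trans
        ((LinearEquiv.prodAssoc R R _ _).symm.trans
          ((Fin.consLinearEquiv R (fun _ : Fin (α + 1) => R)).prodCongr (LinearEquiv.refl R _))))⟩⟩
    · push Not at hu
      obtain ⟨β, ⟨e⟩⟩ := aux_torsion (R := R) N (fun a ha x => by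
        apply hj
        rw [map_zero, map_smul]
        ext i
        exact key a ha _ ((IsLocalRing.mem_maximalIdeal _).mpr (hu i x)))
      exact ⟨0, β, ⟨e.trans (LinearEquiv.uniqueProd).symm⟩⟩

theorem structure_of_finiteRedPd_of_maximalIdeal_sq_zero
    (R : Type u) [CommRing R] [IsNoetherianRing R] [IsLocalRing R]
    (hm2 : (IsLocalRing.maximalIdeal R) ^ 2 = ⊥)
    (M : ModuleCat.{u} R) (hM : Module.Finite R M)
    (hred : FiniteRedPd R M) :
    ∃ α β : ℕ,
      Nonempty ((M : Type u) ≃ₗ[R] (Fin α → R) × (Fin β → IsLocalRing.ResidueField R)) := by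
  obtain ⟨r, K, hK0, ⟨hfin, a, b, n, ha, -, -, hses⟩, m, hres⟩ := hred
  have hfree : Module.Free R (K (Fin.last r)) :=
    aux_free_of_pd hm2 m _ (hfin _) (aux_pd_of_resolved m _ hres)
  have hemb : ∀ i : Fin (r + 1), ∃ f : K i →ₗ[R] K (Fin.last r), Function.Injective f := by
    intro i
    induction i using Fin.reverseInduction with
    | last => exact ⟨LinearMap.id, Function.injective_id⟩
    | cast i ih =>
      obtain ⟨f, hf⟩ := ih
      obtain ⟨S, -, g, -, hg, -, -⟩ := hses i
      let c : K i.castSucc →ₗ[R] (Fin (a i) → K i.castSucc) :=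
        LinearMap.pi (fun _ => LinearMap.id)
      have hc : Function.Injective c := fun x y h => congrFun h ⟨0, ha i⟩
      let g' : (Fin (a i) → K i.castSucc) →ₗ[R] K i.succ := g
      exact ⟨f.comp (g'.comp c), hf.comp (Function.Injective.comp (g := g') hg hc)⟩
  obtain ⟨f, hf⟩ := hemb 0
  subst hK0
  have := hfin (Fin.last r)
  let bs := Module.finBasis R (K (Fin.last r))
  exact aux_sub hm2 _ (K 0) (bs.equivFun.toLinearMap.comp f) (bs.equivFun.injective.comp hf)
end

section
/- Let R be a commutative Noetherian local ring, M and N finitely generated R-modules, and p ≥ 1 an integer such that Ext^p_R(M,N) ≠ 0 and Ext^j_R(M,N) = 0 for all j > p. Let K_0 = M, K_1, …, K_r be a reducing sequence for M. Then for each i = 0, …, r one has Ext^p_R(K_i, N) ≠ 0 and Ext^j_R(K_i, N) = 0 for all j > p. -/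
open CategoryTheory

universe u

variable (R : Type u) [CommRing R]

section Helpers

/-- Vanishing of the derived-category `Ext`. -/
def AV (M N : ModuleCat.{u} R) (i : ℕ) : Prop := ∀ x : Abelian.Ext.{u} M N i, x = 0

variable {R}

theorem extVanishes_iff (M N : ModuleCat.{u} R) (p : ℕ) :
    ExtVanishes R M N (p + 1) ↔ AV R M N (p + 1) := by
  let P := projectiveResolution M
  have h1 : AV R M N (p + 1) ↔ ∀ f : P.complex.X (p + 1) ⟶ N,
      P.complex.d (p + 2) (p + 1) ≫ f = 0 → ∃ g : P.complex.X p ⟶ N,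
        P.complex.d (p + 1) p ≫ g = f := by
    constructor
    · intro h f hf
      exact (P.extMk_eq_zero_iff f (p + 2) rfl hf p rfl).1 (h _)
    · intro h x
      obtain ⟨f, hf, rfl⟩ := P.extMk_surjective x (p + 2) rfl
      exact (P.extMk_eq_zero_iff f (p + 2) rfl hf p rfl).2 (h f hf)
  have h2 : ExtVanishes R M N (p + 1) ↔
      Limits.IsZero ((P.complex.linearYonedaObj R N).homology (p + 1)) := by
    rw [← (P.isoExt (R := R) (p + 1) N).isZero_iff]
    unfold ExtVanishes
    exact (ModuleCat.isZero_iff_subsingleton).symm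
  rw [h1, h2, ← HomologicalComplex.exactAt_iff_isZero_homology,
    HomologicalComplex.exactAt_iff' _ p (p + 1) (p + 2) (by simp) (by simp),
    ShortComplex.moduleCat_exact_iff]
  constructor
  · intro h f hf
    exact h f hf
  · intro h f hf
    exact h f hf

theorem extVanishes_iff' (M N : ModuleCat.{u} R) (j : ℕ) (hj : 1 ≤ j) :
    ExtVanishes R M N j ↔ AV R M N j := by
  obtain ⟨p, rfl⟩ : ∃ p, j = p + 1 := ⟨j - 1, by omega⟩
  exact extVanishes_iff M N p

theorem AV.of_retract {A B N : ModuleCat.{u} R} {j : ℕ} (i : A ⟶ B) (q : B ⟶ A)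
    (hiq : i ≫ q = 𝟙 A) (h : AV R B N j) : AV R A N j := by
  intro x
  rw [← Abelian.Ext.mk₀_id_comp x, ← hiq, ← Abelian.Ext.mk₀_comp_mk₀_assoc,
    h ((Abelian.Ext.mk₀ q).comp x (zero_add j)), Abelian.Ext.comp_zero]

theorem SES.exists_shortExact {A B C : ModuleCat.{u} R} (h : SES R A B C) :
    ∃ (f : A ⟶ B) (g : B ⟶ C) (w : f ≫ g = 0), (ShortComplex.mk f g w).ShortExact := by
  obtain ⟨f, g, hf, hg, hfg⟩ := h
  have hex : Function.Exact f g := LinearMap.exact_iff.2 hfg.symm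
  refine ⟨ModuleCat.ofHom f, ModuleCat.ofHom g, ?_, ?_⟩
  · ext x
    exact hex.apply_apply_eq_zero x
  · refine ShortComplex.ShortExact.mk' ?_ ?_ ?_
    · exact (ShortComplex.ShortExact.moduleCat_exact_iff_function_exact _).2 hex
    · exact (ModuleCat.mono_iff_injective _).2 hf
    · exact (ModuleCat.epi_iff_surjective _).2 hg

theorem AV.mid {A B C N : ModuleCat.{u} R} {j : ℕ} (h : SES R A B C)
    (hA : AV R A N j) (hC : AV R C N j) : AV R B N j := by
  obtain ⟨f, g, w, hS⟩ := h.exists_shortExact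
  intro x
  obtain ⟨y, rfl⟩ := Abelian.Ext.contravariant_sequence_exact₂ hS N x (hA _)
  rw [hC y, Abelian.Ext.comp_zero]

theorem AV.left {A B C N : ModuleCat.{u} R} {j : ℕ} (h : SES R A B C)
    (hB : AV R B N j) (hC : AV R C N (j + 1)) : AV R A N j := by
  obtain ⟨f, g, w, hS⟩ := h.exists_shortExact
  intro x
  obtain ⟨y, rfl⟩ := Abelian.Ext.contravariant_sequence_exact₁ hS N x (add_comm 1 j) (hC _)
  rw [hB y, Abelian.Ext.comp_zero]

theorem AV.mpow {M N : ModuleCat.{u} R} {j : ℕ} (h : AV R M N j) (a : ℕ) :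
    AV R (MPow R M a) N j := by
  induction a with
  | zero =>
    intro x
    have : (𝟙 (MPow R M 0)) = 0 := by
      ext y
      exact funext fun k : Fin 0 => k.elim0
    rw [← Abelian.Ext.mk₀_id_comp x, this, Abelian.Ext.mk₀_zero, Abelian.Ext.zero_comp]
  | succ a ih =>
    refine AV.mid (A := M) (C := MPow R M a) ?_ h ih
    let g : (Fin (a + 1) → M) →ₗ[R] (Fin a → M) := LinearMap.funLeft R M Fin.succ
    refine ⟨(LinearMap.single R (fun _ : Fin (a + 1) => M) 0 : M →ₗ[R] (Fin (a + 1) → M)), g,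
      ?_, ?_, ?_⟩
    · exact Pi.single_injective (M := fun _ : Fin (a + 1) => M) 0
    · exact LinearMap.funLeft_surjective_of_injective R M _ (Fin.succ_injective a)
    · apply le_antisymm
      · rintro _ ⟨x, rfl⟩
        change g (Pi.single 0 x) = 0
        ext k
        simp [g, LinearMap.funLeft]
      · intro (y : Fin (a + 1) → M) (hy : g y = 0)
        refine ⟨y 0, ?_⟩
        change Pi.single 0 (y 0) = y
        funext k
        refine Fin.cases ?_ (fun k => ?_) k
        · simp
        · have := congrFun hy k
          simpa [g, LinearMap.funLeft] using this.symm

theorem AV.of_mpow {M N : ModuleCat.{u} R} {j a : ℕ} (ha : 0 < a)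
    (h : AV R (MPow R M a) N j) : AV R M N j := by
  let k : Fin a := ⟨0, ha⟩
  let i : M →ₗ[R] (Fin a → M) := LinearMap.single R (fun _ : Fin a => M) k
  let q : (Fin a → M) →ₗ[R] M := LinearMap.proj k
  refine AV.of_retract (B := MPow R M a) (ModuleCat.ofHom i) (ModuleCat.ofHom q) ?_ h
  ext x
  change q (i x) = x
  simp [q, i]

theorem AV.of_free {F N : ModuleCat.{u} R} (hF : IsFinFree R F) (j : ℕ) :
    AV R F N (j + 1) := by
  have := hF.2
  have : Projective F := (IsProjective.iff_projective (R := R) F).1 (Module.Projective.of_free)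
  intro x
  exact Abelian.Ext.eq_zero_of_projective x

theorem AV.syzygy {N : ModuleCat.{u} R} (p : ℕ) (n : ℕ) :
    ∀ (S K : ModuleCat.{u} R), IsSyzygy R n S K → (∀ j, p < j → AV R K N j) →
      ∀ j, p < j → AV R S N j := by
  induction n with
  | zero =>
    rintro S K ⟨e⟩ h j hj
    exact AV.of_retract e.toModuleIso.hom e.toModuleIso.inv e.toModuleIso.hom_inv_id (h j hj)
  | succ n ih =>
    rintro S K ⟨T, F, hT, hF, hS⟩ h j hj
    obtain ⟨i, rfl⟩ : ∃ i, j = i + 1 := ⟨j - 1, by omega⟩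
    exact AV.left hS (AV.of_free hF i) (ih T K hT h _ (by omega))

theorem step_main {N : ModuleCat.{u} R} {p : ℕ} {K L S : ModuleCat.{u} R}
    {a b n : ℕ} (ha : 0 < a) (hS : IsSyzygy R n S (MPow R K b))
    (hL : SES R (MPow R K a) L S)
    (hne : ¬ AV R K N p) (hv : ∀ j, p < j → AV R K N j) :
    ¬ AV R L N p ∧ ∀ j, p < j → AV R L N j := by
  have hSv := AV.syzygy p n S _ hS (fun j hj => (hv j hj).mpow b)
  refine ⟨fun h => hne (AV.of_mpow ha (AV.left hL h (hSv _ (by omega)))), fun j hj => ?_⟩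
  exact AV.mid hL ((hv j hj).mpow a) (hSv j hj)

end Helpers

theorem ext_nonvanishing_along_reducing_seq
    (R : Type u) [CommRing R] [IsNoetherianRing R] [IsLocalRing R]
    (M N : ModuleCat.{u} R) (hM : Module.Finite R M) (hN : Module.Finite R N)
    (p : ℕ) (hp : 1 ≤ p)
    (hne : ¬ ExtVanishes R M N p)
    (hvan : ∀ j : ℕ, p < j → ExtVanishes R M N j)
    (r : ℕ) (K : Fin (r + 1) → ModuleCat.{u} R)
    (hK0 : K 0 = M) (hK : IsReducingSeq R K) :
    ∀ i : Fin (r + 1),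
      ¬ ExtVanishes R (K i) N p ∧ ∀ j : ℕ, p < j → ExtVanishes R (K i) N j := by
  have key : ∀ i : Fin (r + 1),
      ¬ AV R (K i) N p ∧ ∀ j : ℕ, p < j → AV R (K i) N j := by
    obtain ⟨-, a, b, n, ha, -, -, hs⟩ := hK
    intro i
    induction i using Fin.induction with
    | zero =>
      rw [hK0]
      exact ⟨fun h => hne ((extVanishes_iff' M N p hp).2 h),
        fun j hj => (extVanishes_iff' M N j (by omega)).1 (hvan j hj)⟩
    | succ i ih =>
      obtain ⟨S, hS, hL⟩ := hs i
      exact step_main (ha i) hS hL ih.1 ih.2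
  intro i
  exact ⟨fun h => (key i).1 ((extVanishes_iff' _ N p hp).1 h),
    fun j hj => (extVanishes_iff' _ N j (by omega)).2 ((key i).2 j hj)⟩
end

section
/- Let R be a commutative Noetherian local ring and N a finitely generated R-module. Let S be the kernel of a surjective R-linear map F → N with F finitely generated free (a first syzygy of N). If Ext^i_R(S,R) = 0 for all i ≥ 1 and S has finite reducing Gorenstein dimension, then N has finite reducing Gorenstein dimension. -/
open CategoryTheory

universe u

variable (R : Type u) [CommRing R]

universe v

/-- All positive Ext groups into `R` vanish (derived category version). -/
def EV (R : Type v) [CommRing R] (M : ModuleCat.{v} R) : Prop :=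
  ∀ n : ℕ, 1 ≤ n → Subsingleton (Abelian.Ext.{v} M (ModuleCat.of R R) n)

theorem ev_of_extVanishes (R : Type v) [CommRing R] (M : ModuleCat.{v} R)
    (h : ∀ i : ℕ, 1 ≤ i → ExtVanishes R M (ModuleCat.of R R) i) : EV R M := by
  intro n hn
  obtain ⟨p, rfl⟩ : ∃ p, n = p + 1 := ⟨n - 1, by omega⟩
  have h1 := h (p + 1) hn
  let P := projectiveResolution M
  have hz : Limits.IsZero
      (((Ext R (ModuleCat.{v} R) (p+1)).obj (Opposite.op M)).obj (ModuleCat.of R R)) := by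
    unfold ExtVanishes at h1
    exact ModuleCat.isZero_of_subsingleton _
  have hz2 := hz.of_iso (P.isoExt (R := R) (p+1) (ModuleCat.of R R)).symm
  rw [← HomologicalComplex.exactAt_iff_isZero_homology,
    HomologicalComplex.exactAt_iff' _ p (p+1) (p+2) (by simp) (by simp),
    ShortComplex.moduleCat_exact_iff] at hz2
  refine subsingleton_of_forall_eq 0 fun α => ?_
  obtain ⟨f, hf, rfl⟩ := P.extMk_surjective α (p+2) rfl
  rw [P.extMk_eq_zero_iff f (p+2) rfl hf p rfl]
  obtain ⟨g, hg⟩ := hz2 f hf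
  exact ⟨g, hg⟩

theorem shortExact_of_SES {R : Type v} [CommRing R] {A B C : ModuleCat.{v} R}
    (f : A →ₗ[R] B) (g : B →ₗ[R] C)
    (hf : Function.Injective f) (hg : Function.Surjective g)
    (h : LinearMap.range f = LinearMap.ker g) :
    ∃ w, (ShortComplex.mk (ModuleCat.ofHom f) (ModuleCat.ofHom g) w).ShortExact := by
  have w : ModuleCat.ofHom f ≫ ModuleCat.ofHom g = 0 := by
    ext x
    have : f x ∈ LinearMap.ker g := h ▸ LinearMap.mem_range_self f x
    simpa using this
  refine ⟨w, ?_⟩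
  have : Mono (ModuleCat.ofHom f) := (ModuleCat.mono_iff_injective _).2 hf
  have : Epi (ModuleCat.ofHom g) := (ModuleCat.epi_iff_surjective _).2 hg
  refine { exact := ?_, mono_f := ‹_›, epi_g := ‹_› }
  rw [ShortComplex.moduleCat_exact_iff]
  intro x hx
  have : x ∈ LinearMap.range f := by rw [h]; exact hx
  exact this

theorem EV.of_projective {R : Type v} [CommRing R] (M : ModuleCat.{v} R) [Module.Projective R M] :
    EV R M := by
  intro n hn
  obtain ⟨p, rfl⟩ : ∃ p, n = p + 1 := ⟨n - 1, by omega⟩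
  have : Projective M := (IsProjective.iff_projective M).1 inferInstance
  exact Abelian.Ext.subsingleton_of_projective _ _ _

theorem EV.of_ext {R : Type v} [CommRing R] {A B C : ModuleCat.{v} R} (h : SES R A B C)
    (hA : EV R A) (hC : EV R C) : EV R B := by
  obtain ⟨f, g, h1, h2, h3⟩ := h
  obtain ⟨w, hS⟩ := shortExact_of_SES f g h1 h2 h3
  intro n hn
  have := hA n hn
  have := hC n hn
  refine subsingleton_of_forall_eq 0 fun x => ?_
  obtain ⟨y, rfl⟩ := Abelian.Ext.contravariant_sequence_exact₂ hS _ x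
    (@Subsingleton.elim _ (hA n hn) _ _)
  rw [@Subsingleton.elim _ (hC n hn) y 0, Abelian.Ext.comp_zero]

theorem EV.of_ker {R : Type v} [CommRing R] {A B C : ModuleCat.{v} R} (h : SES R A B C)
    (hB : EV R B) (hC : EV R C) : EV R A := by
  obtain ⟨f, g, h1, h2, h3⟩ := h
  obtain ⟨w, hS⟩ := shortExact_of_SES f g h1 h2 h3
  intro n hn
  refine subsingleton_of_forall_eq 0 fun x => ?_
  obtain ⟨y, rfl⟩ := Abelian.Ext.contravariant_sequence_exact₁ hS _ x (n₁ := 1 + n) rfl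
    (@Subsingleton.elim _ (hC (1 + n) (by omega)) _ _)
  rw [@Subsingleton.elim _ (hB n hn) y 0, Abelian.Ext.comp_zero]

theorem EV.extend_one {R : Type v} [CommRing R] {A B C : ModuleCat.{v} R}
    (f : A →ₗ[R] B) (g : B →ₗ[R] C)
    (hf : Function.Injective f) (hg : Function.Surjective g)
    (h : LinearMap.range f = LinearMap.ker g) (hC : EV R C) (φ : A →ₗ[R] R) :
    ∃ ψ : B →ₗ[R] R, ψ ∘ₗ f = φ := by
  obtain ⟨w, hS⟩ := shortExact_of_SES f g hf hg h
  obtain ⟨y, hy⟩ := Abelian.Ext.contravariant_sequence_exact₁ hS (ModuleCat.of R R)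
    (Abelian.Ext.mk₀ (ModuleCat.ofHom φ)) (n₁ := 1) rfl
    (@Subsingleton.elim _ (hC 1 le_rfl) _ _)
  obtain ⟨ψ, rfl⟩ := Abelian.Ext.addEquiv₀.symm.surjective y
  simp only [Abelian.Ext.addEquiv₀_symm_apply, Abelian.Ext.mk₀_comp_mk₀] at hy
  have := Abelian.Ext.addEquiv₀.symm.injective hy
  exact ⟨ψ.hom, by simpa using congrArg ModuleCat.Hom.hom this⟩

theorem EV.extend {R : Type v} [CommRing R] {A B C : ModuleCat.{v} R}
    (f : A →ₗ[R] B) (g : B →ₗ[R] C)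
    (hf : Function.Injective f) (hg : Function.Surjective g)
    (h : LinearMap.range f = LinearMap.ker g) (hC : EV R C)
    (W : ModuleCat.{v} R) (hW : IsFinFree R W) (φ : A →ₗ[R] W) :
    ∃ ψ : B →ₗ[R] W, ψ ∘ₗ f = φ := by
  obtain ⟨h1, h2⟩ := hW
  let b := Module.Free.chooseBasis R W
  choose ψ hψ using fun i => EV.extend_one f g hf hg h hC (b.coord i ∘ₗ φ)
  refine ⟨∑ i, (ψ i).smulRight (b i), ?_⟩
  ext x
  have : ∀ i, ψ i (f x) = b.repr (φ x) i := fun i => by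
    have := LinearMap.congr_fun (hψ i) x
    simpa using this
  simp [this, b.sum_repr]

theorem SES.mpow {R : Type v} [CommRing R] {A B C : ModuleCat.{v} R} (h : SES R A B C) (a : ℕ) :
    SES R (MPow R A a) (MPow R B a) (MPow R C a) := by
  obtain ⟨f, g, h1, h2, h3⟩ := h
  refine ⟨(LinearMap.compLeft f (Fin a) : (Fin a → A) →ₗ[R] (Fin a → B)),
    (LinearMap.compLeft g (Fin a) : (Fin a → B) →ₗ[R] (Fin a → C)), ?_, ?_, ?_⟩
  · exact h1.comp_left
  · exact h2.comp_left
  · ext (x : Fin a → B)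
    constructor
    · rintro ⟨y, rfl⟩
      refine funext fun i => ?_
      have : f (y i) ∈ LinearMap.ker g := h3 ▸ LinearMap.mem_range_self f (y i)
      exact this
    · intro hx
      have : ∀ i, ∃ y, f y = x i := fun i => by
        have : x i ∈ LinearMap.range f := by
          rw [h3]; exact congrFun hx i
        exact this
      choose y hy using this
      exact ⟨y, funext hy⟩

theorem IsFinFree.mpow {R : Type v} [CommRing R] {F : ModuleCat.{v} R} (h : IsFinFree R F)
    (a : ℕ) : IsFinFree R (MPow R F a) := by
  obtain ⟨h1, h2⟩ := h
  exact ⟨inferInstanceAs (Module.Finite R (Fin a → F)),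
    inferInstanceAs (Module.Free R (Fin a → F))⟩

theorem EV.mpow {R : Type v} [CommRing R] {M : ModuleCat.{v} R} (h : EV R M) (a : ℕ) :
    EV R (MPow R M a) := by
  induction a with
  | zero =>
    have : Subsingleton (MPow R M 0) := inferInstanceAs (Subsingleton (Fin 0 → M))
    have : Module.Projective R (MPow R M 0) := inferInstance
    exact EV.of_projective _
  | succ a ih =>
    refine EV.of_ext (A := M) (C := MPow R M a) ?_ h ih
    refine ⟨(LinearMap.single R (fun _ : Fin (a+1) => (M : Type v)) 0),
      (LinearMap.funLeft R M Fin.succ : (Fin (a+1) → M) →ₗ[R] (Fin a → M)), ?_, ?_, ?_⟩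
    · exact Pi.single_injective (M := fun _ : Fin (a+1) => (M : Type v)) 0
    · exact LinearMap.funLeft_surjective_of_injective R M _ (Fin.succ_injective a)
    · ext (x : Fin (a+1) → M)
      constructor
      · rintro ⟨y, rfl⟩
        refine funext fun i => ?_
        exact Pi.single_eq_of_ne (M := fun _ : Fin (a+1) => (M : Type v)) (Fin.succ_ne_zero i) y
      · intro hx
        refine ⟨x 0, funext fun i => ?_⟩
        refine Fin.cases ?_ (fun j => ?_) i
        · exact Pi.single_eq_same (M := fun _ : Fin (a+1) => (M : Type v)) 0 (x 0)
        · exact (Pi.single_eq_of_ne (M := fun _ : Fin (a+1) => (M : Type v)) (Fin.succ_ne_zero j) (x 0)).trans (congrFun hx j).symm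

theorem SES.of_equiv {R : Type v} [CommRing R] {A A' B C : ModuleCat.{v} R} (e : A' ≃ₗ[R] A)
    (h : SES R A B C) : SES R A' B C := by
  obtain ⟨f, g, h1, h2, h3⟩ := h
  refine ⟨f ∘ₗ e.toLinearMap, g, h1.comp e.injective, h2, ?_⟩
  rw [← h3, LinearMap.range_comp, LinearEquiv.range, Submodule.map_top]

theorem EV.of_equiv {R : Type v} [CommRing R] {A A' : ModuleCat.{v} R} (e : A' ≃ₗ[R] A)
    (h : EV R A) : EV R A' := by
  refine EV.of_ker (B := A) (C := ModuleCat.of R PUnit.{v+1}) ?_ h (EV.of_projective _)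
  exact ⟨e.toLinearMap, 0, e.injective, fun _ => ⟨0, Subsingleton.elim _ _⟩, by simp⟩

theorem EV.syzygy {R : Type v} [CommRing R] {n : ℕ} {S K : ModuleCat.{v} R}
    (h : IsSyzygy R n S K) (hK : EV R K) : EV R S := by
  induction n generalizing S with
  | zero => exact EV.of_equiv h.some hK
  | succ n ih =>
    obtain ⟨T, F, hT, ⟨hF1, hF2⟩, hs⟩ := h
    exact EV.of_ker hs (EV.of_projective _) (ih hT)

theorem IsSyzygy.shift {R : Type v} [CommRing R] {n : ℕ} {T K F N : ModuleCat.{v} R}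
    (h : IsSyzygy R n T K) (hF : IsFinFree R F) (hs : SES R K F N) :
    IsSyzygy R (n + 1) T N := by
  induction n generalizing T with
  | zero => exact ⟨N, F, ⟨LinearEquiv.refl R N⟩, hF, hs.of_equiv h.some⟩
  | succ n ih =>
    obtain ⟨T', F', hT, hF', hs'⟩ := h
    exact ⟨T', F', ih hT, hF', hs'⟩

theorem horseshoe_rev {R : Type v} [CommRing R] {A B C W X G T : ModuleCat.{v} R}
    (f : A →ₗ[R] B) (g : B →ₗ[R] C)
    (hf : Function.Injective f) (hg : Function.Surjective g)
    (h : LinearMap.range f = LinearMap.ker g)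
    (f1 : A →ₗ[R] W) (g1 : W →ₗ[R] X)
    (hf1 : Function.Injective f1) (hg1 : Function.Surjective g1)
    (h1 : LinearMap.range f1 = LinearMap.ker g1)
    (h2 : SES R C G T) (ψ : B →ₗ[R] W) (hψ : ψ ∘ₗ f = f1) :
    ∃ Y : ModuleCat.{v} R, SES R B (ModuleCat.of R (W × G)) Y ∧ SES R X Y T := by
  obtain ⟨f2, g2, hf2, hg2, h2⟩ := h2
  have hψ' : ∀ a, ψ (f a) = f1 a := fun a => LinearMap.congr_fun hψ a
  have hgf : ∀ a, g (f a) = 0 := fun a => by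
    have : f a ∈ LinearMap.ker g := h ▸ LinearMap.mem_range_self f a
    exact this
  have hgf1 : ∀ a, g1 (f1 a) = 0 := fun a => by
    have : f1 a ∈ LinearMap.ker g1 := h1 ▸ LinearMap.mem_range_self f1 a
    exact this
  have hgf2 : ∀ a, g2 (f2 a) = 0 := fun a => by
    have : f2 a ∈ LinearMap.ker g2 := h2 ▸ LinearMap.mem_range_self f2 a
    exact this
  have ex : ∀ b, g b = 0 → ∃ a, f a = b := fun b hb => by
    have : b ∈ LinearMap.range f := by rw [h]; exact hb
    exact this
  have ex1 : ∀ b, g1 b = 0 → ∃ a, f1 a = b := fun b hb => by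
    have : b ∈ LinearMap.range f1 := by rw [h1]; exact hb
    exact this
  have ex2 : ∀ b, g2 b = 0 → ∃ a, f2 a = b := fun b hb => by
    have : b ∈ LinearMap.range f2 := by rw [h2]; exact hb
    exact this
  have key : ∀ b, f2 (g b) = 0 → ∃ a, f a = b := fun b hb =>
    ex b (hf2 (by rw [hb, map_zero]))
  let θ : B →ₗ[R] (W × G) := ψ.prod (f2 ∘ₗ g)
  have hθ : ∀ b, θ b = (ψ b, f2 (g b)) := fun b => rfl
  let I := LinearMap.range θ
  let p : ((W × G) ⧸ I) →ₗ[R] T := I.liftQ (g2 ∘ₗ LinearMap.snd R W G) (by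
    rintro _ ⟨b, rfl⟩
    simp [hθ, hgf2])
  have hp : ∀ w c, p (I.mkQ (w, c)) = g2 c := fun w c => rfl
  let k : W →ₗ[R] ((W × G) ⧸ I) := I.mkQ ∘ₗ LinearMap.inl R W G
  have hk : ∀ w, k w = I.mkQ (w, 0) := fun w => rfl
  have hkz : ∀ w, k w = 0 ↔ g1 w = 0 := fun w => by
    rw [hk, Submodule.mkQ_apply, Submodule.Quotient.mk_eq_zero]
    constructor
    · rintro ⟨b, hb⟩
      rw [hθ, Prod.mk.injEq] at hb
      obtain ⟨a, rfl⟩ := key b hb.2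
      rw [← hb.1, hψ', hgf1]
    · intro hw
      obtain ⟨a, rfl⟩ := ex1 w hw
      exact ⟨f a, by rw [hθ, hψ', hgf, map_zero]⟩
  let q : X →ₗ[R] ((W × G) ⧸ I) :=
    (LinearMap.ker g1).liftQ k (fun w hw => (hkz w).2 hw) ∘ₗ
      (g1.quotKerEquivOfSurjective hg1).symm.toLinearMap
  have hq : ∀ w, q (g1 w) = k w := fun w => by
    have : (g1.quotKerEquivOfSurjective hg1).symm (g1 w) = (LinearMap.ker g1).mkQ w := by
      rw [LinearEquiv.symm_apply_eq]; rfl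
    simp only [q, LinearMap.comp_apply, LinearEquiv.coe_coe, this]
    rfl
  refine ⟨ModuleCat.of R ((W × G) ⧸ I), ⟨θ, I.mkQ, ?_, I.mkQ_surjective, ?_⟩, ⟨q, p, ?_, ?_, ?_⟩⟩
  · rw [injective_iff_map_eq_zero]
    intro b hb
    have hb' : (ψ b, f2 (g b)) = ((0 : W), (0 : G)) := hb
    rw [Prod.mk.injEq] at hb'
    obtain ⟨a, rfl⟩ := key b hb'.2
    have : a = 0 := hf1 (by rw [← hψ', hb'.1, map_zero])
    rw [this, map_zero]
  · exact (Submodule.ker_mkQ I).symm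
  · rw [injective_iff_map_eq_zero]
    intro x hx
    obtain ⟨w, rfl⟩ := hg1 x
    rw [hq, hkz] at hx
    exact hx
  · intro t
    obtain ⟨c, rfl⟩ := hg2 t
    exact ⟨I.mkQ (0, c), hp _ _⟩
  · ext y
    constructor
    · rintro ⟨x, rfl⟩
      obtain ⟨w, rfl⟩ := hg1 x
      rw [LinearMap.mem_ker, hq, hk, hp, map_zero]
    · intro hy
      obtain ⟨⟨w, c⟩, rfl⟩ := I.mkQ_surjective y
      obtain ⟨d, rfl⟩ := ex2 c (by rw [← hp w c]; exact hy)
      obtain ⟨b, rfl⟩ := hg d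
      refine ⟨g1 (w - ψ b), ?_⟩
      rw [hq, hk, ← sub_eq_zero, ← map_sub]
      rw [Submodule.mkQ_apply, Submodule.Quotient.mk_eq_zero]
      exact ⟨-b, by simp [hθ]⟩

theorem IsFinFree.totallyReflexive {R : Type v} [CommRing R] {F : ModuleCat.{v} R}
    (h : IsFinFree R F) : IsTotallyReflexive R F := by
  obtain ⟨h1, h2⟩ := h
  have aux : ∀ (M : ModuleCat.{v} R) [Module.Projective R M] (i : ℕ), 1 ≤ i →
      ExtVanishes R M (ModuleCat.of R R) i := by
    intro M _ i hi
    obtain ⟨p, rfl⟩ : ∃ p, i = p + 1 := ⟨i - 1, by omega⟩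
    have : Projective M := (IsProjective.iff_projective M).1 inferInstance
    exact ModuleCat.subsingleton_of_isZero (isZero_Ext_succ_of_projective M _ p)
  exact ⟨Module.bijective_dual_eval R F, fun i hi => ⟨aux _ i hi, aux _ i hi⟩⟩

theorem redSeq_aux {R : Type v} [CommRing R] (r : ℕ) :
    ∀ (K : Fin (r + 1) → ModuleCat.{v} R) (N F : ModuleCat.{v} R), Module.Finite R N →
      IsFinFree R F → SES R (K 0) F N → EV R (K 0) → IsReducingSeq R K →
      FiniteGdim R (K (Fin.last r)) → FiniteRedGdim R N := by
  induction r with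
  | zero =>
    intro K N F hN hF hs _ _ hG
    refine ⟨0, fun _ => N, rfl, ⟨fun _ => hN, Fin.elim0, Fin.elim0, Fin.elim0,
      fun i => i.elim0, fun i => i.elim0, fun i => i.elim0, fun i => i.elim0⟩, ?_⟩
    obtain ⟨m, hm⟩ := hG
    exact ⟨m + 1, F, K 0, hF.totallyReflexive, hs, hm⟩
  | succ r ih =>
    intro K N F hN hF hs hE hK hG
    obtain ⟨hfin, a, b, n, ha, hb, hn, hstep⟩ := hK
    obtain ⟨S, hS, hses⟩ := hstep 0
    have hEb : EV R S := EV.syzygy hS (EV.mpow hE _)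
    have hE1 : EV R (K (Fin.succ 0)) := EV.of_ext hses (EV.mpow hE _) hEb
    obtain ⟨m, hm⟩ : ∃ m, n 0 = m + 1 := ⟨n 0 - 1, by have := hn 0; omega⟩
    rw [hm] at hS
    obtain ⟨T, G, hT, hGf, hSG⟩ := hS
    have hTN : IsSyzygy R (m + 1) T (MPow R N (b 0)) := hT.shift (hF.mpow _) (hs.mpow _)
    obtain ⟨f, g, h1, h2, h3⟩ := hses
    obtain ⟨f1, g1, h4, h5, h6⟩ := hs.mpow (a 0)
    have hW := hF.mpow (a 0)
    obtain ⟨ψ, hψ⟩ := EV.extend f g h1 h2 h3 hEb _ hW f1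
    obtain ⟨Y, hY1, hY2⟩ := horseshoe_rev f g h1 h2 h3 f1 g1 h4 h5 h6 hSG ψ hψ
    have hWG : IsFinFree R (ModuleCat.of R (MPow R F (a 0) × G)) := by
      obtain ⟨_, _⟩ := hW
      obtain ⟨_, _⟩ := hGf
      exact ⟨inferInstanceAs (Module.Finite R (MPow R F (a 0) × G)),
        inferInstanceAs (Module.Free R (MPow R F (a 0) × G))⟩
    have hYf : Module.Finite R Y := by
      obtain ⟨_, g, _, hg, _⟩ := hY1
      have := hWG.1
      exact Module.Finite.of_surjective g hg
    obtain ⟨s, L, hL0, ⟨hLf, a', b', n', ha', hb', hn', hstep'⟩, hLG⟩ :=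
      ih (fun i => K i.succ) Y _ hYf hWG hY1 hE1
      ⟨fun i => hfin _, fun i => a i.succ, fun i => b i.succ, fun i => n i.succ,
        fun i => ha _, fun i => hb _, fun i => hn _, fun i => hstep i.succ⟩ hG
    refine ⟨s + 1, Fin.cons N L, rfl, ⟨?_, Fin.cons (a 0) a', Fin.cons (b 0) b',
      Fin.cons (m + 1) n', ?_, ?_, ?_, ?_⟩, hLG⟩
    · exact Fin.cases hN hLf
    · exact Fin.cases (ha 0) ha'
    · exact Fin.cases (hb 0) hb'
    · exact Fin.cases (Nat.succ_pos m) hn'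
    · refine Fin.cases ⟨T, hTN, ?_⟩ (fun i => hstep' i)
      subst hL0
      exact hY2

theorem finiteRedGdim_of_syzygy
    (R : Type u) [CommRing R] [IsNoetherianRing R] [IsLocalRing R]
    (N F : ModuleCat.{u} R) (hN : Module.Finite R N) (hF : IsFinFree R F)
    (π : F →ₗ[R] N) (hπ : Function.Surjective π)
    (hext : ∀ i : ℕ, 1 ≤ i →
      ExtVanishes R (ModuleCat.of R (LinearMap.ker π)) (ModuleCat.of R R) i)
    (hred : FiniteRedGdim R (ModuleCat.of R (LinearMap.ker π))) :
    FiniteRedGdim R N := by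
  obtain ⟨r, K, hK0, hK, hG⟩ := hred
  have hs : SES R (ModuleCat.of R (LinearMap.ker π)) F N :=
    ⟨(LinearMap.ker π).subtype, π, Subtype.val_injective, hπ, by simp⟩
  have hE := ev_of_extVanishes R _ hext
  rw [← hK0] at hs hE
  exact redSeq_aux r K N F hN hF hs hE hK hG
end
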